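/- arXiv:2401.16574 — 3 statements merged into one kernel-verified Lean document; each statement's English description precedes it below -/
import Mathlib

section
/- Under the RA model with W irreducible: for every ε > 0 and every δ ∈ (0,1/2) there exists a time t* ∈ ℕ such that for every S ∈ ℕ, P(∩_{s=0}^S C_{t*+s}^𝟘(δ)) + P(∩_{s=0}^S C_{t*+s}^𝟙(δ)) > 1 − ε. In particular, x_t converges almost surely to a random limit taking values in {𝟘, 𝟙} (almost sure convergence to consensus). -/
open MeasureTheory ProbabilityTheory Filter

namespace RA

variable {Ω : Type*}

/-- History σ-algebra generated by `x 1, …, x t` and `a 1, …, a (t-1)`. -/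
def hist {N : ℕ} [MeasurableSpace Ω] (x a : ℕ → Ω → Fin N → ℝ) (t : ℕ) :
    MeasurableSpace Ω :=
  (⨆ s ∈ Finset.Icc 1 t, MeasurableSpace.comap (x s) inferInstance) ⊔
  (⨆ s ∈ Finset.Ico 1 t, MeasurableSpace.comap (a s) inferInstance)

/-- The Random Actions (RA) opinion dynamics model. -/
structure IsRAModel {N : ℕ} [MeasurableSpace Ω] (μ : Measure Ω) (α : ℝ)
    (W : Matrix (Fin N) (Fin N) ℝ) (x a : ℕ → Ω → Fin N → ℝ) : Prop where
  isProb : IsProbabilityMeasure μ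
  alpha_mem : α ∈ Set.Ioo (0 : ℝ) 1
  W_nonneg : ∀ i j, 0 ≤ W i j
  W_rowsum : ∀ i, ∑ j, W i j = 1
  x_meas : ∀ t, Measurable (x t)
  a_meas : ∀ t, Measurable (a t)
  x_mem : ∀ t, 1 ≤ t → ∀ ω i, x t ω i ∈ Set.Icc (0 : ℝ) 1
  a_mem : ∀ t, 1 ≤ t → ∀ ω i, a t ω i = 0 ∨ a t ω i = 1
  update : ∀ t, 1 ≤ t → ∀ ω i,
    x (t + 1) ω i = (1 - α) * x t ω i + α * ∑ j, W i j * a t ω j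
  bernoulli : ∀ t, 1 ≤ t → ∀ b : Fin N → Bool, ∀ H : Set Ω,
    MeasurableSet[hist x a t] H →
    (μ (H ∩ {ω | ∀ i, a t ω i = if b i then (1 : ℝ) else 0})).toReal
      = ∫ ω in H, ∏ i, (if b i then x t ω i else 1 - x t ω i) ∂μ

/-- `W` is irreducible: the network is strongly connected. -/
def Irreducible {N : ℕ} (W : Matrix (Fin N) (Fin N) ℝ) : Prop :=
  ∀ i j, ∃ n : ℕ, 0 < (W ^ n) i j

/-- The event that `x t i ∈ [0,δ) ∪ (1-δ,1]`. -/
def cti {N : ℕ} (x : ℕ → Ω → Fin N → ℝ) (δ : ℝ) (t : ℕ) (i : Fin N) : Set Ω :=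
  {ω | x t ω i < δ ∨ 1 - δ < x t ω i}

def ct {N : ℕ} (x : ℕ → Ω → Fin N → ℝ) (δ : ℝ) (t : ℕ) : Set Ω :=
  ⋂ i, cti x δ t i

def c0 {N : ℕ} (x : ℕ → Ω → Fin N → ℝ) (δ : ℝ) (t : ℕ) (i : Fin N) : Set Ω :=
  {ω | x t ω i < δ}

def c1 {N : ℕ} (x : ℕ → Ω → Fin N → ℝ) (δ : ℝ) (t : ℕ) (i : Fin N) : Set Ω :=
  {ω | 1 - δ < x t ω i}

/-- The event that every coordinate of `x t` is within `δ` of `0`. -/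
def corner0 {N : ℕ} (x : ℕ → Ω → Fin N → ℝ) (δ : ℝ) (t : ℕ) : Set Ω :=
  {ω | ∀ i, x t ω i < δ}

/-- The event that every coordinate of `x t` is within `δ` of `1`. -/
def corner1 {N : ℕ} (x : ℕ → Ω → Fin N → ℝ) (δ : ℝ) (t : ℕ) : Set Ω :=
  {ω | ∀ i, 1 - δ < x t ω i}

/-- Agents `i` and `j` communicate. -/
def Communicates {N : ℕ} (W : Matrix (Fin N) (Fin N) ℝ) (i j : Fin N) : Prop :=
  (∃ n : ℕ, 0 < (W ^ n) j i) ∧ (∃ n : ℕ, 0 < (W ^ n) i j)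

/-- `C` is a communication class (strongly connected component). -/
def CommClass {N : ℕ} (W : Matrix (Fin N) (Fin N) ℝ) (C : Set (Fin N)) : Prop :=
  ∃ i, C = {j | Communicates W i j}

/-- `C` is a maximal communication class: no agent outside `C` has a directed
path into `C`. -/
def IsMaximalClass {N : ℕ} (W : Matrix (Fin N) (Fin N) ℝ) (C : Set (Fin N)) : Prop :=
  CommClass W C ∧ ∀ i ∈ C, ∀ j, (∃ n : ℕ, 0 < (W ^ n) i j) → j ∈ C

lemma matrix_pow_nonneg {N : ℕ} {W : Matrix (Fin N) (Fin N) ℝ} (hW : ∀ i j, 0 ≤ W i j)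
    (n : ℕ) (i j : Fin N) : 0 ≤ (W ^ n) i j := by
  induction n generalizing i j with
  | zero => simp only [pow_zero, Matrix.one_apply]; split_ifs <;> norm_num
  | succ n ih =>
    rw [pow_succ, Matrix.mul_apply]
    exact Finset.sum_nonneg fun k _ => mul_nonneg (ih i k) (hW k j)

/-- A row-stochastic irreducible matrix has a strictly positive left fixed vector. -/
lemma exists_pos_vecMul_eq {N : ℕ} (hN : 1 ≤ N) {W : Matrix (Fin N) (Fin N) ℝ}
    (hW : ∀ i j, 0 ≤ W i j) (hrow : ∀ i, ∑ j, W i j = 1) (hirr : Irreducible W) :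
    ∃ p : Fin N → ℝ, (∀ j, 0 < p j) ∧ ∀ j, ∑ i, p i * W i j = p j := by
  have : Nonempty (Fin N) := ⟨⟨0, hN⟩⟩
  have hdet : (W - 1).det = 0 := by
    refine Matrix.exists_mulVec_eq_zero_iff.mp ⟨fun _ => 1, ?_, ?_⟩
    · intro h
      exact one_ne_zero (congrFun h ⟨0, hN⟩)
    · rw [Matrix.sub_mulVec, Matrix.one_mulVec]
      ext i
      simp [Matrix.mulVec, dotProduct, hrow]
  obtain ⟨v, hv0, hv⟩ := Matrix.exists_vecMul_eq_zero_iff.mpr hdet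
  have hvW : Matrix.vecMul v W = v := by
    rw [Matrix.vecMul_sub, Matrix.vecMul_one] at hv
    exact sub_eq_zero.mp hv
  have hle : ∀ j ∈ Finset.univ, |v j| ≤ ∑ i, |v i| * W i j := by
    intro j _
    calc |v j| = |∑ i, v i * W i j| := by
          conv_lhs => rw [← hvW]
          simp [Matrix.vecMul, dotProduct]
      _ ≤ ∑ i, |v i * W i j| := Finset.abs_sum_le_sum_abs _ _
      _ = ∑ i, |v i| * W i j := by simp [abs_mul, abs_of_nonneg (hW _ _)]
  have hsum : ∑ j, |v j| = ∑ j, ∑ i, |v i| * W i j := by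
    rw [Finset.sum_comm]
    simp [← Finset.mul_sum, hrow]
  have heq := (Finset.sum_eq_sum_iff_of_le hle).mp hsum
  set p : Fin N → ℝ := fun i => |v i| with hp
  have hpW : Matrix.vecMul p W = p := by
    ext j
    simp only [Matrix.vecMul, dotProduct]
    exact (heq j (Finset.mem_univ j)).symm
  have hpow : ∀ n : ℕ, Matrix.vecMul p (W ^ n) = p := by
    intro n
    induction n with
    | zero => simp
    | succ n ih => rw [pow_succ, ← Matrix.vecMul_vecMul, ih, hpW]
  obtain ⟨i, hi⟩ := Function.ne_iff.mp hv0
  refine ⟨p, fun j => ?_, fun j => (heq j (Finset.mem_univ j)).symm⟩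
  obtain ⟨n, hn⟩ := hirr i j
  rw [← hpow n]
  simp only [Matrix.vecMul, dotProduct]
  exact Finset.sum_pos' (fun k _ => mul_nonneg (abs_nonneg (v k)) (matrix_pow_nonneg hW n k j))
    ⟨i, Finset.mem_univ i, mul_pos (abs_pos.mpr hi) hn⟩

/-- A `{0,1}`-valued fixed vector of an irreducible nonnegative matrix is constant. -/
lemma eq_zero_or_eq_one_of_mulVec_eq {N : ℕ} {W : Matrix (Fin N) (Fin N) ℝ}
    (hW : ∀ i j, 0 ≤ W i j) (hirr : Irreducible W)
    {c : Fin N → ℝ} (hc : ∀ i, c i = 0 ∨ c i = 1) (hfix : ∀ i, ∑ j, W i j * c j = c i) :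
    (∀ i, c i = 0) ∨ ∀ i, c i = 1 := by
  have hcW : Matrix.mulVec W c = c := funext hfix
  have hpow : ∀ n : ℕ, Matrix.mulVec (W ^ n) c = c := by
    intro n
    induction n with
    | zero => simp
    | succ n ih => rw [pow_succ, ← Matrix.mulVec_mulVec, hcW, ih]
  by_contra! h
  obtain ⟨⟨i, hi⟩, ⟨j, hj⟩⟩ := h
  have hi1 : c i = 1 := (hc i).resolve_left hi
  have hj0 : c j = 0 := (hc j).resolve_right hj
  obtain ⟨n, hn⟩ := hirr j i
  have hpos : 0 < Matrix.mulVec (W ^ n) c j :=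
    Finset.sum_pos' (fun k _ => mul_nonneg (matrix_pow_nonneg hW n j k) (by rcases hc k with h | h <;> simp [h]))
      ⟨i, Finset.mem_univ i, by rw [hi1, mul_one]; exact hn⟩
  rw [hpow n, hj0] at hpos
  exact lt_irrefl _ hpos

/-- The centred product of independent Bernoulli variables has mean zero. -/
lemma sum_prod_sub_mul_bernoulli_eq_zero {N : ℕ} (y : Fin N → ℝ) {s : Finset (Fin N)}
    (hs : s.Nonempty) :
    ∑ b : Fin N → Bool, (∏ k ∈ s, ((if b k then (1 : ℝ) else 0) - y k)) *
      ∏ k, (if b k then y k else 1 - y k) = 0 := by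
  obtain ⟨j, hj⟩ := hs
  have hfac : ∀ b : Fin N → Bool, (∏ k ∈ s, ((if b k then (1 : ℝ) else 0) - y k)) *
      ∏ k, (if b k then y k else 1 - y k) =
      ∏ k, ((if k ∈ s then (if b k then (1 : ℝ) else 0) - y k else 1) *
        (if b k then y k else 1 - y k)) := by
    intro b
    rw [Finset.prod_mul_distrib, Finset.prod_ite_mem, Finset.univ_inter]
  simp only [hfac]
  rw [← Fintype.prod_sum (fun k (c : Bool) =>
    (if k ∈ s then (if c then (1 : ℝ) else 0) - y k else 1) * (if c then y k else 1 - y k))]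
  refine Finset.prod_eq_zero (Finset.mem_univ j) ?_
  simp only [hj, if_true, Fintype.sum_bool, Bool.false_eq_true, if_false]
  ring

section Model

variable [MeasurableSpace Ω] {N : ℕ} {μ : Measure Ω} {α : ℝ}
  {W : Matrix (Fin N) (Fin N) ℝ} {x a : ℕ → Ω → Fin N → ℝ}

lemma IsRAModel.integrable_comp (h : IsRAModel μ α W x a) {t : ℕ} (ht : 1 ≤ t)
    {Φ : (Fin N → ℝ) × (Fin N → ℝ) → ℝ} (hΦ : Continuous Φ) :
    Integrable (fun ω => Φ (x t ω, a t ω)) μ := by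
  have := h.isProb
  obtain ⟨C, hC⟩ := (isCompact_Icc (a := (0 : (Fin N → ℝ) × (Fin N → ℝ)))
    (b := 1)).exists_bound_of_continuousOn hΦ.continuousOn
  refine Integrable.of_bound
    (hΦ.measurable.comp ((h.x_meas t).prodMk (h.a_meas t))).aestronglyMeasurable C
    (Eventually.of_forall fun ω => hC _ ?_)
  have ha : ∀ i, 0 ≤ a t ω i ∧ a t ω i ≤ 1 := fun i => by
    rcases h.a_mem t ht ω i with h | h <;> simp [h]
  exact ⟨⟨fun i => (h.x_mem t ht ω i).1, fun i => (ha i).1⟩,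
    ⟨fun i => (h.x_mem t ht ω i).2, fun i => (ha i).2⟩⟩

/-- Given `x t`, the action profile equals `b` with the product Bernoulli probability. -/
lemma IsRAModel.setIntegral_action_eq (h : IsRAModel μ α W x a) {t : ℕ} (ht : 1 ≤ t)
    {g : (Fin N → ℝ) → ℝ} (hg : Measurable g) (b : Fin N → Bool) :
    ∫ ω in {ω | ∀ i, a t ω i = if b i then (1 : ℝ) else 0}, g (x t ω) ∂μ =
      ∫ ω, (∏ i, (if b i then x t ω i else 1 - x t ω i)) * g (x t ω) ∂μ := by
  have := h.isProb
  set p : (Fin N → ℝ) → ℝ := fun y => ∏ i, (if b i then y i else 1 - y i)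
  have hpc : Continuous p := by
    refine continuous_finsetProd _ fun i _ => ?_
    split_ifs <;> fun_prop
  have hpx : Measurable fun ω => p (x t ω) := hpc.measurable.comp (h.x_meas t)
  have hp0 : ∀ ω, 0 ≤ p (x t ω) := fun ω => Finset.prod_nonneg fun i _ => by
    have := h.x_mem t ht ω i
    split_ifs
    · exact this.1
    · linarith [this.2]
  have hpint : Integrable (fun ω => p (x t ω)) μ :=
    h.integrable_comp ht (Φ := fun z => p z.1) (hpc.comp continuous_fst)
  have hmeas : (μ.restrict {ω | ∀ i, a t ω i = if b i then (1 : ℝ) else 0}).map (x t) =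
      (μ.withDensity fun ω => ENNReal.ofReal (p (x t ω))).map (x t) := by
    ext B hB
    have hBx := h.x_meas t hB
    rw [Measure.map_apply (h.x_meas t) hB, Measure.map_apply (h.x_meas t) hB,
      Measure.restrict_apply hBx, withDensity_apply _ hBx,
      ← ofReal_integral_eq_lintegral_ofReal hpint.integrableOn
        (Eventually.of_forall hp0), ← h.bernoulli t ht b _ ?_,
      ENNReal.ofReal_toReal (measure_ne_top _ _)]
    refine (le_sup_of_le_left (le_iSup₂_of_le t (Finset.mem_Icc.mpr ⟨ht, le_rfl⟩) le_rfl) :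
      MeasurableSpace.comap (x t) inferInstance ≤ hist x a t) _ ⟨B, hB, rfl⟩
  rw [← integral_map (h.x_meas t).aemeasurable hg.aestronglyMeasurable, hmeas,
    integral_map (h.x_meas t).aemeasurable hg.aestronglyMeasurable,
    integral_withDensity_eq_integral_toReal_smul hpx.ennreal_ofReal
      (Eventually.of_forall fun _ => ENNReal.ofReal_lt_top)]
  refine integral_congr_ae (Eventually.of_forall fun ω => ?_)
  change (ENNReal.ofReal (p (x t ω))).toReal • g (x t ω) = p (x t ω) * g (x t ω)
  rw [ENNReal.toReal_ofReal (hp0 ω), smul_eq_mul]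

/-- Products of distinct innovations `a t k - x t k` are orthogonal to functions of `x t`. -/
lemma IsRAModel.integral_mul_prod_sub_eq_zero (h : IsRAModel μ α W x a) {t : ℕ} (ht : 1 ≤ t)
    {g : (Fin N → ℝ) → ℝ} (hg : Continuous g) {s : Finset (Fin N)} (hs : s.Nonempty) :
    ∫ ω, g (x t ω) * ∏ k ∈ s, (a t ω k - x t ω k) ∂μ = 0 := by
  have := h.isProb
  set A : (Fin N → Bool) → Set Ω := fun b => {ω | ∀ i, a t ω i = if b i then (1 : ℝ) else 0}
    with hA
  have hAmeas : ∀ b, MeasurableSet (A b) := fun b => by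
    have hset : A b = a t ⁻¹' {fun i => if b i then (1 : ℝ) else 0} := by
      ext ω
      simp [hA, funext_iff]
    rw [hset]
    exact h.a_meas t (measurableSet_singleton _)
  have hdisj : Pairwise (Function.onFun Disjoint A) := by
    intro b c hbc
    rw [Function.onFun, Set.disjoint_left]
    intro ω hb hc
    refine hbc (funext fun i => ?_)
    have := (hb i).symm.trans (hc i)
    rcases hbi : b i <;> rcases hci : c i <;> simp_all
  have hcover : ⋃ b, A b = Set.univ := by
    refine Set.eq_univ_of_forall fun ω => Set.mem_iUnion.mpr
      ⟨fun i => decide (a t ω i = 1), fun i => ?_⟩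
    rcases h.a_mem t ht ω i with h | h <;> simp [h]
  set G : (Fin N → Bool) → (Fin N → ℝ) → ℝ :=
    fun b y => g y * ∏ k ∈ s, ((if b k then (1 : ℝ) else 0) - y k) with hG
  have hGc : ∀ b, Continuous (G b) := fun b => by
    refine hg.mul (continuous_finsetProd _ fun k _ => by fun_prop)
  have hpc : ∀ b : Fin N → Bool,
      Continuous fun y : Fin N → ℝ => ∏ i, (if b i then y i else 1 - y i) := fun b => by
    refine continuous_finsetProd _ fun i _ => ?_
    split_ifs <;> fun_prop
  have hint : Integrable (fun ω => g (x t ω) * ∏ k ∈ s, (a t ω k - x t ω k)) μ :=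
    h.integrable_comp ht (Φ := fun z => g z.1 * ∏ k ∈ s, (z.2 k - z.1 k))
      ((hg.comp continuous_fst).mul (continuous_finsetProd _ fun k _ => by fun_prop))
  rw [← setIntegral_univ, ← hcover, integral_iUnion_fintype hAmeas hdisj
    (fun b => hint.integrableOn)]
  have hb : ∀ b, ∫ ω in A b, g (x t ω) * ∏ k ∈ s, (a t ω k - x t ω k) ∂μ =
      ∫ ω, (∏ i, (if b i then x t ω i else 1 - x t ω i)) * G b (x t ω) ∂μ := by
    intro b
    rw [← h.setIntegral_action_eq ht (hGc b).measurable b]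
    refine setIntegral_congr_fun (hAmeas b) fun ω hω => ?_
    simp only [hG]
    congr 1
    exact Finset.prod_congr rfl fun k _ => by rw [hω k]
  simp only [hb]
  rw [← integral_finsetSum]
  · refine integral_eq_zero_of_ae (Eventually.of_forall fun ω => ?_)
    have := sum_prod_sub_mul_bernoulli_eq_zero (x t ω) hs
    calc ∑ b : Fin N → Bool, (∏ i, (if b i then x t ω i else 1 - x t ω i)) * G b (x t ω)
        = g (x t ω) * ∑ b : Fin N → Bool,
            (∏ k ∈ s, ((if b k then (1 : ℝ) else 0) - x t ω k)) *
              ∏ k, (if b k then x t ω k else 1 - x t ω k) := by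
          rw [Finset.mul_sum]
          exact Finset.sum_congr rfl fun b _ => by simp only [hG]; ring
      _ = 0 := by rw [this, mul_zero]
  · intro b _
    exact h.integrable_comp ht
      (Φ := fun z => (∏ i, (if b i then z.1 i else 1 - z.1 i)) * G b z.1)
      (((hpc b).mul (hGc b)).comp continuous_fst)

/-- Second-moment recursion for the martingale `∑ i, p i * x t i`. -/
lemma IsRAModel.integral_sq_succ (h : IsRAModel μ α W x a) {p : Fin N → ℝ}
    (hp : ∀ j, ∑ i, p i * W i j = p j) {t : ℕ} (ht : 1 ≤ t) :
    ∫ ω, (∑ i, p i * x (t + 1) ω i) ^ 2 ∂μ = ∫ ω, (∑ i, p i * x t ω i) ^ 2 ∂μ +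
      α ^ 2 * ∑ j, p j ^ 2 * ∫ ω, (a t ω j - x t ω j) ^ 2 ∂μ := by
  have := h.isProb
  have hstep : ∀ ω, ∑ i, p i * x (t + 1) ω i =
      ∑ i, p i * x t ω i + α * ∑ j, p j * (a t ω j - x t ω j) := by
    intro ω
    have hswap : ∑ i, p i * ∑ j, W i j * a t ω j = ∑ j, p j * a t ω j := by
      simp only [Finset.mul_sum]
      rw [Finset.sum_comm]
      refine Finset.sum_congr rfl fun j _ => ?_
      rw [← hp j, Finset.sum_mul]
      exact Finset.sum_congr rfl fun i _ => by ring
    calc ∑ i, p i * x (t + 1) ω i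
        = ∑ i, ((1 - α) * (p i * x t ω i) + α * (p i * ∑ j, W i j * a t ω j)) :=
          Finset.sum_congr rfl fun i _ => by rw [h.update t ht ω i]; ring
      _ = _ := by
          rw [Finset.sum_add_distrib, ← Finset.mul_sum, ← Finset.mul_sum, hswap]
          simp only [mul_sub, Finset.sum_sub_distrib]
          ring
  have hexp : ∀ ω, (∑ i, p i * x (t + 1) ω i) ^ 2 = (∑ i, p i * x t ω i) ^ 2 +
      (∑ j, 2 * α * p j * ((∑ i, p i * x t ω i) * (a t ω j - x t ω j)) +
      ∑ i, ∑ j, α ^ 2 * p i * p j * ((a t ω i - x t ω i) * (a t ω j - x t ω j))) := by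
    intro ω
    have h1 : ∑ j, 2 * α * p j * ((∑ i, p i * x t ω i) * (a t ω j - x t ω j)) =
        2 * α * (∑ i, p i * x t ω i) * ∑ j, p j * (a t ω j - x t ω j) := by
      rw [Finset.mul_sum]
      exact Finset.sum_congr rfl fun j _ => by ring
    have h2 : ∑ i, ∑ j, α ^ 2 * p i * p j * ((a t ω i - x t ω i) * (a t ω j - x t ω j)) =
        α ^ 2 * ((∑ j, p j * (a t ω j - x t ω j)) * ∑ j, p j * (a t ω j - x t ω j)) := by
      rw [Finset.sum_mul_sum, Finset.mul_sum]
      refine Finset.sum_congr rfl fun i _ => ?_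
      rw [Finset.mul_sum]
      exact Finset.sum_congr rfl fun j _ => by ring
    rw [hstep, h1, h2]
    ring
  have hlin : ∀ j, ∫ ω, (∑ i, p i * x t ω i) * (a t ω j - x t ω j) ∂μ = 0 := fun j => by
    simpa using h.integral_mul_prod_sub_eq_zero ht (g := fun y => ∑ i, p i * y i)
      (by fun_prop) (Finset.singleton_nonempty j)
  have hcross : ∀ i j, i ≠ j → ∫ ω, (a t ω i - x t ω i) * (a t ω j - x t ω j) ∂μ = 0 :=
    fun i j hij => by
      simpa [Finset.prod_pair hij] using h.integral_mul_prod_sub_eq_zero ht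
        (g := fun _ => 1) continuous_const (Finset.insert_nonempty i {j})
  have i1 : Integrable (fun ω => (∑ i, p i * x t ω i) ^ 2) μ :=
    h.integrable_comp ht (Φ := fun z => (∑ i, p i * z.1 i) ^ 2) (by fun_prop)
  have i2 : ∀ j, Integrable
      (fun ω => 2 * α * p j * ((∑ i, p i * x t ω i) * (a t ω j - x t ω j))) μ := fun j =>
    h.integrable_comp ht
      (Φ := fun z => 2 * α * p j * ((∑ i, p i * z.1 i) * (z.2 j - z.1 j))) (by fun_prop)
  have i3 : ∀ i j, Integrable
      (fun ω => α ^ 2 * p i * p j * ((a t ω i - x t ω i) * (a t ω j - x t ω j))) μ :=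
    fun i j => h.integrable_comp ht
      (Φ := fun z => α ^ 2 * p i * p j * ((z.2 i - z.1 i) * (z.2 j - z.1 j))) (by fun_prop)
  have i4 : ∀ i, Integrable
      (fun ω => ∑ j, α ^ 2 * p i * p j * ((a t ω i - x t ω i) * (a t ω j - x t ω j))) μ :=
    fun i => integrable_finsetSum _ fun j _ => i3 i j
  simp only [hexp]
  have i5 := integrable_finsetSum Finset.univ fun j _ => i2 j
  have i6 := integrable_finsetSum Finset.univ fun i _ => i4 i
  have i56 : Integrable (fun ω =>
      ∑ j, 2 * α * p j * ((∑ i, p i * x t ω i) * (a t ω j - x t ω j)) +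
      ∑ i, ∑ j, α ^ 2 * p i * p j * ((a t ω i - x t ω i) * (a t ω j - x t ω j))) μ := i5.add i6
  rw [integral_add i1 i56, integral_add i5 i6,
    integral_finsetSum _ fun j _ => i2 j, integral_finsetSum _ fun i _ => i4 i]
  simp only [integral_const_mul, hlin, mul_zero, Finset.sum_const_zero, zero_add]
  rw [Finset.mul_sum]
  congr 1
  refine Finset.sum_congr rfl fun i _ => ?_
  rw [integral_finsetSum _ fun j _ => i3 i j, Finset.sum_eq_single i]
  · rw [integral_const_mul]
    simp only [← sq]
    ring
  · intro j _ hji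
    rw [integral_const_mul, hcross i j hji.symm, mul_zero]
  · simp

/-- Nonnegative functions whose integrals have bounded partial sums tend to zero a.e. -/
lemma ae_tendsto_zero_of_sum_integral_le {f : ℕ → Ω → ℝ}
    (hf : ∀ n, Integrable (f n) μ) (hf0 : ∀ n ω, 0 ≤ f n ω) {C : ℝ}
    (hC : ∀ n, ∑ k ∈ Finset.range n, ∫ ω, f k ω ∂μ ≤ C) :
    ∀ᵐ ω ∂μ, Tendsto (fun n => f n ω) atTop (nhds 0) := by
  have hsum : Summable fun k => ∫ ω, f k ω ∂μ :=
    summable_of_sum_range_le (fun k => integral_nonneg (hf0 k)) hC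
  have hmeas : ∀ n, AEMeasurable (fun ω => ENNReal.ofReal (f n ω)) μ := fun n =>
    (hf n).aemeasurable.ennreal_ofReal
  have hfin : ∫⁻ ω, ∑' n, ENNReal.ofReal (f n ω) ∂μ ≠ ⊤ := by
    rw [lintegral_tsum hmeas]
    simp_rw [← ofReal_integral_eq_lintegral_ofReal (hf _) (Eventually.of_forall (hf0 _))]
    exact hsum.tsum_ofReal_ne_top
  filter_upwards [ae_lt_top' (AEMeasurable.tsum hmeas) hfin] with ω hω
  have h0 := ENNReal.tendsto_atTop_zero_of_tsum_ne_top hω.ne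
  have h1 := (ENNReal.tendsto_toReal ENNReal.zero_ne_top).comp h0
  simpa [Function.comp_def, ENNReal.toReal_ofReal (hf0 _ ω)] using h1

lemma IsRAModel.ae_tendsto_sub (h : IsRAModel μ α W x a) (hN : 1 ≤ N) (hirr : Irreducible W) :
    ∀ᵐ ω ∂μ, ∀ j, Tendsto (fun t => a (t + 1) ω j - x (t + 1) ω j) atTop (nhds 0) := by
  have := h.isProb
  obtain ⟨p, hp0, hp⟩ := exists_pos_vecMul_eq hN h.W_nonneg h.W_rowsum hirr
  have hα := h.alpha_mem.1
  rw [ae_all_iff]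
  intro j
  set V : ℕ → ℝ := fun t => ∫ ω, (∑ i, p i * x (t + 1) ω i) ^ 2 ∂μ with hV
  have hstep : ∀ t, α ^ 2 * p j ^ 2 * ∫ ω, (a (t + 1) ω j - x (t + 1) ω j) ^ 2 ∂μ ≤
      V (t + 1) - V t := by
    intro t
    have hsingle := Finset.single_le_sum
      (f := fun j => p j ^ 2 * ∫ ω, (a (t + 1) ω j - x (t + 1) ω j) ^ 2 ∂μ)
      (fun k _ => mul_nonneg (sq_nonneg _) (integral_nonneg fun ω => sq_nonneg _))
      (Finset.mem_univ j)
    have := mul_le_mul_of_nonneg_left hsingle (sq_nonneg α)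
    simp only [hV]
    rw [h.integral_sq_succ hp (Nat.le_add_left 1 t)]
    linarith
  have hVle : ∀ t, V t ≤ (∑ i, p i) ^ 2 := by
    intro t
    have hpt : ∀ ω, (∑ i, p i * x (t + 1) ω i) ^ 2 ≤ (∑ i, p i) ^ 2 := fun ω => by
      have hx := h.x_mem (t + 1) (Nat.le_add_left 1 t) ω
      refine pow_le_pow_left₀ (Finset.sum_nonneg fun i _ =>
        mul_nonneg (hp0 i).le (hx i).1) (Finset.sum_le_sum fun i _ => ?_) 2
      exact mul_le_of_le_one_right (hp0 i).le (hx i).2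
    calc V t ≤ ∫ _, (∑ i, p i) ^ 2 ∂μ := integral_mono
          (h.integrable_comp (Nat.le_add_left 1 t)
            (Φ := fun z => (∑ i, p i * z.1 i) ^ 2) (by fun_prop))
          (integrable_const _) hpt
      _ = (∑ i, p i) ^ 2 := by simp
  have hV0 : 0 ≤ V 0 := integral_nonneg fun ω => sq_nonneg _
  have hpos : 0 < α ^ 2 * p j ^ 2 := mul_pos (pow_pos hα 2) (pow_pos (hp0 j) 2)
  have hbound : ∀ n, ∑ t ∈ Finset.range n, ∫ ω, (a (t + 1) ω j - x (t + 1) ω j) ^ 2 ∂μ ≤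
      (∑ i, p i) ^ 2 / (α ^ 2 * p j ^ 2) := by
    intro n
    rw [le_div_iff₀' hpos, Finset.mul_sum]
    calc _ ≤ ∑ t ∈ Finset.range n, (V (t + 1) - V t) := Finset.sum_le_sum fun t _ => hstep t
      _ = V n - V 0 := Finset.sum_range_sub V n
      _ ≤ _ := by linarith [hVle n]
  filter_upwards [ae_tendsto_zero_of_sum_integral_le
    (f := fun t ω => (a (t + 1) ω j - x (t + 1) ω j) ^ 2)
    (fun t => h.integrable_comp (Nat.le_add_left 1 t)
      (Φ := fun z => (z.2 j - z.1 j) ^ 2) (by fun_prop))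
    (fun t ω => sq_nonneg _) hbound] with ω hω
  have := hω.sqrt
  simp only [Real.sqrt_sq_eq_abs, Real.sqrt_zero] at this
  exact (tendsto_zero_iff_abs_tendsto_zero _).mpr this

/-- If actions asymptotically agree with states along a trajectory, the trajectory converges to
consensus. -/
lemma IsRAModel.tendsto_consensus (h : IsRAModel μ α W x a) (hirr : Irreducible W) {ω : Ω}
    (hω : ∀ j, Tendsto (fun t => a (t + 1) ω j - x (t + 1) ω j) atTop (nhds 0)) :
    (∀ i, Tendsto (fun t => x t ω i) atTop (nhds 0)) ∨
      (∀ i, Tendsto (fun t => x t ω i) atTop (nhds 1)) := by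
  obtain ⟨hα0, hα1⟩ := h.alpha_mem
  have hclose : ∀ᶠ t in atTop, ∀ j, |a (t + 1) ω j - x (t + 1) ω j| < (1 - α) / 2 := by
    rw [eventually_all]
    intro j
    have := (hω j).abs
    rw [abs_zero] at this
    exact this.eventually_lt_const (by linarith)
  obtain ⟨T, hT⟩ := eventually_atTop.mp hclose
  have hconst : ∀ t, T ≤ t → ∀ i, a (t + 2) ω i = a (t + 1) ω i := by
    intro t ht i
    have h1 := abs_lt.mp (hT t ht i)
    have h2 := abs_lt.mp (hT (t + 1) (by omega) i)
    have hu := h.update (t + 1) (by omega) ω i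
    have hx := h.x_mem (t + 1) (by omega) ω i
    have ha := h.a_mem (t + 1) (by omega) ω
    have hw0 : 0 ≤ ∑ j, W i j * a (t + 1) ω j := Finset.sum_nonneg fun j _ =>
      mul_nonneg (h.W_nonneg i j) (by rcases ha j with h | h <;> simp [h])
    have hw1 : ∑ j, W i j * a (t + 1) ω j ≤ 1 := by
      rw [← h.W_rowsum i]
      exact Finset.sum_le_sum fun j _ => mul_le_of_le_one_right (h.W_nonneg i j)
        (by rcases ha j with h | h <;> simp [h])
    rw [show t + 1 + 1 = t + 2 from rfl] at hu h2
    rcases ha i with h3 | h3 <;> rcases h.a_mem (t + 2) (by omega) ω i with h4 | h4 <;>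
      rw [h3, h4] <;> rw [h3] at h1 <;> rw [h4] at h2 <;> exfalso <;> nlinarith [hx.1, hx.2]
  set c : Fin N → ℝ := a (T + 1) ω with hc
  have hac : ∀ n i, a (T + 1 + n) ω i = c i := by
    intro n i
    induction n with
    | zero => rfl
    | succ n ih => rw [← ih, show T + 1 + (n + 1) = T + n + 2 by omega, hconst (T + n) (by omega),
        show T + 1 + n = T + n + 1 by omega]
  have hatend : ∀ i, Tendsto (fun t => a (t + 1) ω i) atTop (nhds (c i)) := fun i =>
    tendsto_const_nhds.congr' (eventually_atTop.mpr ⟨T, fun t ht => by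
      rw [← hac (t - T) i, show T + 1 + (t - T) = t + 1 by omega]⟩)
  have hxtend : ∀ i, Tendsto (fun t => x (t + 1) ω i) atTop (nhds (c i)) := fun i => by
    simpa using (hatend i).sub (hω i)
  have hfix : ∀ i, ∑ j, W i j * c j = c i := by
    intro i
    have hlim : Tendsto (fun t => (1 - α) * x (t + 1) ω i + α * ∑ j, W i j * a (t + 1) ω j)
        atTop (nhds ((1 - α) * c i + α * ∑ j, W i j * c j)) :=
      ((hxtend i).const_mul _).add
        ((tendsto_finsetSum _ fun j _ => (hatend j).const_mul _).const_mul _)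
    have hshift : Tendsto (fun t => x (t + 1 + 1) ω i) atTop (nhds (c i)) :=
      (hxtend i).comp (tendsto_add_atTop_nat 1)
    have := tendsto_nhds_unique hshift
      (hlim.congr fun t => (h.update (t + 1) (by omega) ω i).symm)
    exact mul_left_cancel₀ hα0.ne' (by linarith)
  have hx' : ∀ i, Tendsto (fun t => x t ω i) atTop (nhds (c i)) := fun i =>
    (tendsto_add_atTop_iff_nat 1).mp (hxtend i)
  rcases eq_zero_or_eq_one_of_mulVec_eq h.W_nonneg hirr
    (fun i => h.a_mem (T + 1) (by omega) ω i) hfix with h0 | h1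
  · exact Or.inl fun i => h0 i ▸ hx' i
  · exact Or.inr fun i => h1 i ▸ hx' i

/-- Almost sure consensus makes the trajectory stay near a consensus corner from a deterministic
time on, with probability close to one. -/
lemma exists_time_corner_of_ae_consensus [IsProbabilityMeasure μ]
    (hae : ∀ᵐ ω ∂μ, (∀ i, Tendsto (fun t => x t ω i) atTop (nhds 0)) ∨
      (∀ i, Tendsto (fun t => x t ω i) atTop (nhds 1)))
    {ε δ : ℝ} (hε : 0 < ε) (hδ : 0 < δ) : ∃ tstar : ℕ, 1 ≤ tstar ∧
      ∀ S : ℕ,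
        (μ (⋂ s ∈ Finset.range (S + 1), corner0 x δ (tstar + s))).toReal
          + (μ (⋂ s ∈ Finset.range (S + 1), corner1 x δ (tstar + s))).toReal
          > 1 - ε := by
  set A : ℕ → Set Ω := fun t => ⋂ s, corner0 x δ (t + s) with hA
  set B : ℕ → Set Ω := fun t => ⋂ s, corner1 x δ (t + s) with hB
  have hmono : Monotone fun t => A t ∪ B t := by
    refine monotone_nat_of_le_succ fun t => Set.union_subset_union ?_ ?_ <;>
    · refine Set.subset_iInter fun s => ?_
      rw [show t + 1 + s = t + (s + 1) by omega]
      exact Set.iInter_subset _ _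
  have hone : μ (⋃ t, A t ∪ B t) = 1 := by
    suffices hu : (⋃ t, A t ∪ B t) =ᵐ[μ] Set.univ by
      rw [measure_congr hu, measure_univ]
    rw [eventuallyEq_univ]
    filter_upwards [hae] with ω hω
    rw [Set.mem_iUnion]
    rcases hω with h0 | h1
    · obtain ⟨T, hT⟩ := eventually_atTop.mp
        (eventually_all.mpr fun i => (h0 i).eventually_lt_const hδ)
      exact ⟨T, Or.inl (Set.mem_iInter.mpr fun s => hT (T + s) (by omega))⟩
    · obtain ⟨T, hT⟩ := eventually_atTop.mp
        (eventually_all.mpr fun i => (h1 i).eventually_const_lt (sub_lt_self 1 hδ))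
      exact ⟨T, Or.inr (Set.mem_iInter.mpr fun s => hT (T + s) (by omega))⟩
  have htend : Tendsto (fun t => (μ (A t ∪ B t)).toReal) atTop (nhds 1) := by
    have := tendsto_measure_iUnion_atTop (μ := μ) hmono
    rw [hone] at this
    exact (ENNReal.tendsto_toReal ENNReal.one_ne_top).comp this
  obtain ⟨t, ht, ht1⟩ := ((htend.eventually_const_lt (sub_lt_self 1 hε)).and
    (eventually_ge_atTop 1)).exists
  refine ⟨t, ht1, fun S => lt_of_lt_of_le ht ?_⟩
  have hsub0 : A t ⊆ ⋂ s ∈ Finset.range (S + 1), corner0 x δ (t + s) :=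
    Set.subset_iInter₂ fun s _ => Set.iInter_subset _ s
  have hsub1 : B t ⊆ ⋂ s ∈ Finset.range (S + 1), corner1 x δ (t + s) :=
    Set.subset_iInter₂ fun s _ => Set.iInter_subset _ s
  calc (μ (A t ∪ B t)).toReal ≤ (μ (A t)).toReal + (μ (B t)).toReal :=
        measureReal_union_le (A t) (B t)
    _ ≤ _ := add_le_add (measureReal_mono hsub0) (measureReal_mono hsub1)

end Model

theorem ra_converges_to_consensus_almost_surely {Ω : Type*} [MeasurableSpace Ω] {N : ℕ} (hN : 1 ≤ N)
    (μ : Measure Ω) (α : ℝ) (W : Matrix (Fin N) (Fin N) ℝ)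
    (x a : ℕ → Ω → Fin N → ℝ) (hRA : IsRAModel μ α W x a)
    (hirr : Irreducible W) :
    (∀ ε > (0 : ℝ), ∀ δ ∈ Set.Ioo (0 : ℝ) (1/2), ∃ tstar : ℕ, 1 ≤ tstar ∧
      ∀ S : ℕ,
        (μ (⋂ s ∈ Finset.range (S + 1), corner0 x δ (tstar + s))).toReal
          + (μ (⋂ s ∈ Finset.range (S + 1), corner1 x δ (tstar + s))).toReal
          > 1 - ε)
    ∧ (∀ᵐ ω ∂μ,
        (∀ i, Filter.Tendsto (fun t => x t ω i) Filter.atTop (nhds 0))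
        ∨ (∀ i, Filter.Tendsto (fun t => x t ω i) Filter.atTop (nhds 1))) := by
  have := hRA.isProb
  have hae : ∀ᵐ ω ∂μ, (∀ i, Tendsto (fun t => x t ω i) atTop (nhds 0)) ∨
      (∀ i, Tendsto (fun t => x t ω i) atTop (nhds 1)) :=
    (hRA.ae_tendsto_sub hN hirr).mono fun ω hω => hRA.tendsto_consensus hirr hω
  exact ⟨fun ε hε δ hδ => exists_time_corner_of_ae_consensus hae hε hδ.1, hae⟩

end RA
end

section
/- Under the RA model with W irreducible: for any δ ∈ (0,1/2), lim_{t→∞} P(C_t(δ)) = 1, where C_t(δ) = ∩_{i=1}^N C_{t,i}(δ) is the event that every coordinate of x_t lies in [0,δ) ∪ (1−δ,1]. -/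
open MeasureTheory ProbabilityTheory Filter

namespace RA

variable {Ω : Type*}

/-- Product functions factorize under the product of Bernoulli laws. -/
lemma sum_bernoulli_mul_prod {ι : Type*} [Fintype ι] [DecidableEq ι] (p : ι → ℝ)
    (h : ι → Bool → ℝ) :
    ∑ b : ι → Bool, (∏ i, if b i then p i else 1 - p i) * ∏ i, h i (b i)
      = ∏ i, (p i * h i true + (1 - p i) * h i false) := by
  have key := Finset.prod_univ_sum (fun _ : ι => (Finset.univ : Finset Bool))
    (fun i c => (if c then p i else 1 - p i) * h i c)
  simp only [Fintype.piFinset_univ, Finset.prod_mul_distrib] at key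
  rw [← key]
  simp

lemma sum_bernoulli {ι : Type*} [Fintype ι] [DecidableEq ι] (p : ι → ℝ) :
    ∑ b : ι → Bool, (∏ i, if b i then p i else 1 - p i) = 1 := by
  simpa using sum_bernoulli_mul_prod p (fun _ _ => 1)

lemma sum_bernoulli_mul_centered {ι : Type*} [Fintype ι] [DecidableEq ι] (p : ι → ℝ) (k : ι) :
    ∑ b : ι → Bool, (∏ i, if b i then p i else 1 - p i) * ((if b k then 1 else 0) - p k) = 0 := by
  have key := sum_bernoulli_mul_prod p
    (fun i c => if i = k then (if c then 1 else 0) - p i else 1)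
  simp only [Finset.prod_ite_eq', Finset.mem_univ, if_true] at key
  rw [key]
  apply Finset.prod_eq_zero (Finset.mem_univ k)
  simp
  ring

lemma sum_bernoulli_mul_centered_mul_centered {ι : Type*} [Fintype ι] [DecidableEq ι]
    (p : ι → ℝ) (k l : ι) :
    ∑ b : ι → Bool, (∏ i, if b i then p i else 1 - p i) *
        (((if b k then 1 else 0) - p k) * ((if b l then 1 else 0) - p l))
      = if k = l then p k * (1 - p k) else 0 := by
  have key := sum_bernoulli_mul_prod p
    (fun i c => (if i = k then (if c then 1 else 0) - p i else 1) *
      (if i = l then (if c then 1 else 0) - p i else 1))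
  simp only [Finset.prod_mul_distrib, Finset.prod_ite_eq', Finset.mem_univ, if_true] at key
  rw [key]
  by_cases hkl : k = l
  · subst hkl
    rw [if_pos rfl, Finset.prod_eq_single k]
    · simp
      ring
    · intro i _ hi
      simp [hi]
    · simp
  · rw [if_neg hkl]
    apply Finset.prod_eq_zero (Finset.mem_univ k)
    simp [hkl]
    ring

/-- Second moment of an affine combination of independent Bernoulli variables. -/
lemma sum_bernoulli_mul_sq {ι : Type*} [Fintype ι] [DecidableEq ι] (p q : ι → ℝ) (m α : ℝ) :
    ∑ b : ι → Bool, (∏ i, if b i then p i else 1 - p i) *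
        (m + α * ∑ i, q i * ((if b i then 1 else 0) - p i)) ^ 2
      = m ^ 2 + α ^ 2 * ∑ i, q i ^ 2 * (p i * (1 - p i)) := by
  have expand : ∀ b : ι → Bool, (∏ i, if b i then p i else 1 - p i) *
        (m + α * ∑ i, q i * ((if b i then 1 else 0) - p i)) ^ 2
      = m ^ 2 * (∏ i, if b i then p i else 1 - p i)
        + ∑ k, 2 * m * α * q k *
          ((∏ i, if b i then p i else 1 - p i) * ((if b k then 1 else 0) - p k))
        + ∑ k, ∑ l, α ^ 2 * q k * q l * ((∏ i, if b i then p i else 1 - p i) *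
          (((if b k then 1 else 0) - p k) * ((if b l then 1 else 0) - p l))) := by
    intro b
    have hsq : (∑ i, q i * ((if b i then 1 else 0) - p i)) ^ 2
        = ∑ k, ∑ l, (q k * ((if b k then 1 else 0) - p k)) *
          (q l * ((if b l then 1 else 0) - p l)) := by
      rw [sq, Finset.sum_mul_sum]
    rw [add_sq, mul_pow, hsq]
    simp only [mul_add, Finset.mul_sum]
    congr 1
    · congr 1
      · ring
      · exact Finset.sum_congr rfl fun k _ => by ring
    · exact Finset.sum_congr rfl fun k _ => Finset.sum_congr rfl fun l _ => by ring
  simp only [expand, Finset.sum_add_distrib]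
  rw [← Finset.mul_sum, sum_bernoulli, Finset.sum_comm]
  simp only [← Finset.mul_sum, sum_bernoulli_mul_centered]
  rw [Finset.sum_comm]
  simp only [Finset.sum_comm (s := (Finset.univ : Finset (ι → Bool))) (t := Finset.univ (α := ι))]
  simp only [← Finset.mul_sum, sum_bernoulli_mul_centered_mul_centered]
  simp only [mul_ite, mul_zero, Finset.sum_ite_eq, Finset.mem_univ, if_true,
    Finset.sum_const_zero, add_zero, mul_one, Finset.mul_sum]
  congr 1
  exact Finset.sum_congr rfl fun k _ => by ring

/-- An irreducible row-stochastic matrix has a positive stationary vector. -/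
lemma exists_pos_stationary {N : ℕ} (hN : 1 ≤ N) (W : Matrix (Fin N) (Fin N) ℝ)
    (hW : ∀ i j, 0 ≤ W i j) (hrow : ∀ i, ∑ j, W i j = 1) (hirr : Irreducible W) :
    ∃ q : Fin N → ℝ, (∀ i, 0 < q i) ∧ ∀ j, ∑ i, q i * W i j = q j := by
  have hdet : (W - 1).det = 0 := by
    rw [← Matrix.exists_mulVec_eq_zero_iff]
    refine ⟨fun _ => 1, fun h => ?_, ?_⟩
    · simpa using congrFun h ⟨0, hN⟩
    · ext i
      rw [Matrix.sub_mulVec, Matrix.one_mulVec]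
      simp [Matrix.mulVec, dotProduct, hrow]
  obtain ⟨v, hv0, hv⟩ := Matrix.exists_vecMul_eq_zero_iff.mpr hdet
  have hv' : ∀ j, ∑ i, v i * W i j = v j := by
    intro j
    have := congrFun hv j
    rw [Matrix.vecMul_sub, Matrix.vecMul_one, Pi.sub_apply, Pi.zero_apply, sub_eq_zero] at this
    exact this
  have hle : ∀ j ∈ Finset.univ, |v j| ≤ ∑ i, |v i| * W i j := by
    intro j _
    calc |v j| = |∑ i, v i * W i j| := by rw [hv']
      _ ≤ ∑ i, |v i * W i j| := Finset.abs_sum_le_sum_abs _ _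
      _ = ∑ i, |v i| * W i j := by simp only [abs_mul, abs_of_nonneg (hW _ _)]
  have hsum : ∑ j, |v j| = ∑ j, ∑ i, |v i| * W i j := by
    rw [Finset.sum_comm]
    simp only [← Finset.mul_sum, hrow, mul_one]
  have heq := (Finset.sum_eq_sum_iff_of_le hle).mp hsum
  have hfix : Matrix.vecMul (fun i => |v i|) W = fun i => |v i| := by
    ext j
    exact (heq j (Finset.mem_univ j)).symm
  have hpow : ∀ n : ℕ, Matrix.vecMul (fun i => |v i|) (W ^ n) = fun i => |v i| := by
    intro n
    induction n with
    | zero => simp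
    | succ n ih => rw [pow_succ, ← Matrix.vecMul_vecMul, ih, hfix]
  have hnonneg : ∀ (n : ℕ) i j, 0 ≤ (W ^ n) i j := by
    intro n
    induction n with
    | zero =>
      intro i j
      rw [pow_zero, Matrix.one_apply]
      split_ifs <;> norm_num
    | succ n ih =>
      intro i j
      rw [pow_succ, Matrix.mul_apply]
      exact Finset.sum_nonneg fun k _ => mul_nonneg (ih i k) (hW k j)
  obtain ⟨k, hk⟩ := Function.ne_iff.mp hv0
  refine ⟨fun i => |v i|, fun i => ?_, fun j => (heq j (Finset.mem_univ j)).symm⟩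
  obtain ⟨n, hn⟩ := hirr k i
  have hki : |v k| * (W ^ n) k i ≤ |v i| := by
    calc |v k| * (W ^ n) k i ≤ ∑ l, |v l| * (W ^ n) l i :=
          Finset.single_le_sum (f := fun l => |v l| * (W ^ n) l i)
            (fun l _ => mul_nonneg (abs_nonneg _) (hnonneg n l i)) (Finset.mem_univ k)
      _ = |v i| := congrFun (hpow n) i
  exact (mul_pos (abs_pos.mpr hk) hn).trans_le hki

lemma pairwise_disjoint_action {N : ℕ} (a : ℕ → Ω → Fin N → ℝ) (t : ℕ) :
    Pairwise (Function.onFun Disjoint fun b : Fin N → Bool =>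
      {ω | ∀ i, a t ω i = if b i then (1 : ℝ) else 0}) := by
  intro b c hbc
  refine Set.disjoint_left.mpr fun ω hb hc => hbc (funext fun i => ?_)
  have h := (hb i).symm.trans (hc i)
  cases hbi : b i <;> cases hci : c i <;> simp [hbi, hci] at h ⊢

namespace IsRAModel

variable {N : ℕ} [MeasurableSpace Ω] {μ : Measure Ω} {α : ℝ} {W : Matrix (Fin N) (Fin N) ℝ}
  {x a : ℕ → Ω → Fin N → ℝ}

lemma hist_le (hRA : IsRAModel μ α W x a) (t : ℕ) : hist x a t ≤ ‹MeasurableSpace Ω› := by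
  refine sup_le ?_ ?_
  · exact iSup₂_le fun s _ => (hRA.x_meas s).comap_le
  · exact iSup₂_le fun s _ => (hRA.a_meas s).comap_le

lemma measurable_hist {t : ℕ} (ht : 1 ≤ t) : Measurable[hist x a t] (x t) := by
  rw [measurable_iff_comap_le]
  refine le_trans ?_ le_sup_left
  exact le_iSup₂_of_le t (Finset.mem_Icc.mpr ⟨ht, le_rfl⟩) le_rfl

lemma integrable_comp_s2 (hRA : IsRAModel μ α W x a) {t : ℕ} (ht : 1 ≤ t)
    {g : (Fin N → ℝ) → ℝ} (hg : Continuous g) : Integrable (fun ω => g (x t ω)) μ := by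
  have := hRA.isProb
  obtain ⟨C, hC⟩ := (isCompact_Icc (a := (0 : Fin N → ℝ)) (b := 1)).exists_bound_of_continuousOn
    hg.continuousOn
  refine Integrable.of_bound (hg.measurable.comp (hRA.x_meas t)).aestronglyMeasurable C ?_
  refine ae_of_all _ fun ω => hC _ ⟨fun i => (hRA.x_mem t ht ω i).1, fun i => (hRA.x_mem t ht ω i).2⟩

lemma measurableSet_action (hRA : IsRAModel μ α W x a) (t : ℕ) (b : Fin N → Bool) :
    MeasurableSet {ω | ∀ i, a t ω i = if b i then (1 : ℝ) else 0} := by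
  rw [Set.ofPred_forall]
  exact MeasurableSet.iInter fun i =>
    measurableSet_eq_fun ((measurable_pi_apply i).comp (hRA.a_meas t)) measurable_const

/-- Averaging a function of the current state over a prescribed action profile. -/
lemma setIntegral_action (hRA : IsRAModel μ α W x a) {t : ℕ} (ht : 1 ≤ t) (b : Fin N → Bool)
    {g : (Fin N → ℝ) → ℝ} (hg : Continuous g) :
    ∫ ω in {ω | ∀ i, a t ω i = if b i then (1 : ℝ) else 0}, g (x t ω) ∂μ
      = ∫ ω, (∏ i, if b i then x t ω i else 1 - x t ω i) * g (x t ω) ∂μ := by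
  have := hRA.isProb
  have hm := hRA.hist_le t
  set A := {ω | ∀ i, a t ω i = if b i then (1 : ℝ) else 0}
  have hcont : Continuous fun y : Fin N → ℝ => ∏ i, if b i then y i else 1 - y i := by
    refine continuous_finsetProd _ fun i _ => ?_
    split_ifs <;> fun_prop
  have hnn : ∀ ω, 0 ≤ ∏ i, if b i then x t ω i else 1 - x t ω i := by
    intro ω
    refine Finset.prod_nonneg fun i _ => ?_
    have := hRA.x_mem t ht ω i
    split_ifs
    · exact this.1
    · linarith [this.2]
  have hint := hRA.integrable_comp_s2 ht hcont
  set ν := μ.withDensity fun ω => ENNReal.ofReal (∏ i, if b i then x t ω i else 1 - x t ω i)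
  have htrim : (μ.restrict A).trim hm = ν.trim hm := by
    refine @Measure.ext _ (hist x a t) _ _ fun H hH => ?_
    rw [trim_measurableSet_eq hm hH, trim_measurableSet_eq hm hH,
      Measure.restrict_apply (hm H hH), withDensity_apply _ (hm H hH),
      ← ofReal_integral_eq_lintegral_ofReal hint.integrableOn (ae_of_all _ hnn),
      ← hRA.bernoulli t ht b H hH, ENNReal.ofReal_toReal (measure_ne_top _ _)]
  have hgm : StronglyMeasurable[hist x a t] fun ω => g (x t ω) :=
    (hg.measurable.comp (measurable_hist ht)).stronglyMeasurable
  have hpm : Measurable fun ω => ENNReal.ofReal (∏ i, if b i then x t ω i else 1 - x t ω i) :=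
    (hcont.measurable.comp (hRA.x_meas t)).ennreal_ofReal
  rw [integral_trim hm hgm, htrim, ← integral_trim hm hgm,
    integral_withDensity_eq_integral_toReal_smul hpm
      (ae_of_all _ fun _ => ENNReal.ofReal_lt_top)]
  simp only [ENNReal.toReal_ofReal (hnn _), smul_eq_mul]

lemma iUnion_action (hRA : IsRAModel μ α W x a) {t : ℕ} (ht : 1 ≤ t) :
    ⋃ b : Fin N → Bool, {ω | ∀ i, a t ω i = if b i then (1 : ℝ) else 0} = Set.univ := by
  classical
  refine Set.eq_univ_of_forall fun ω => Set.mem_iUnion.mpr ⟨fun i => decide (a t ω i = 1), ?_⟩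
  intro i
  rcases hRA.a_mem t ht ω i with h | h <;> simp [h]

/-- The second moment of the stationary average grows by the weighted total variance. -/
lemma integral_sq_succ_s2 (hRA : IsRAModel μ α W x a) {q : Fin N → ℝ}
    (hq : ∀ j, ∑ i, q i * W i j = q j) {t : ℕ} (ht : 1 ≤ t) :
    ∫ ω, (∑ i, q i * x (t + 1) ω i) ^ 2 ∂μ
      = ∫ ω, (∑ i, q i * x t ω i) ^ 2 ∂μ
        + α ^ 2 * ∑ i, q i ^ 2 * ∫ ω, x t ω i * (1 - x t ω i) ∂μ := by
  have hstep : ∀ ω, ∑ i, q i * x (t + 1) ω i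
      = ∑ i, q i * x t ω i + α * ∑ i, q i * (a t ω i - x t ω i) := by
    intro ω
    have h1 : ∑ i, q i * ∑ j, W i j * a t ω j = ∑ j, q j * a t ω j := by
      simp only [Finset.mul_sum, ← mul_assoc]
      rw [Finset.sum_comm]
      simp only [← Finset.sum_mul, hq]
    have h2 : ∑ i, q i * x (t + 1) ω i = (1 - α) * ∑ i, q i * x t ω i
        + α * ∑ i, q i * ∑ j, W i j * a t ω j := by
      rw [Finset.mul_sum, Finset.mul_sum, ← Finset.sum_add_distrib]
      exact Finset.sum_congr rfl fun i _ => by rw [hRA.update t ht ω i]; ring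
    rw [h2, h1]
    simp only [mul_sub, Finset.sum_sub_distrib]
    ring
  have hcw : ∀ b : Fin N → Bool,
      Continuous fun y : Fin N → ℝ => ∏ i, if b i then y i else 1 - y i := by
    intro b
    refine continuous_finsetProd _ fun i _ => ?_
    split_ifs <;> fun_prop
  have hcg : ∀ b : Fin N → Bool, Continuous fun y : Fin N → ℝ =>
      (∑ i, q i * y i + α * ∑ i, q i * ((if b i then 1 else 0) - y i)) ^ 2 := by
    intro b
    fun_prop
  have hvar : ∀ i, Continuous fun y : Fin N → ℝ => y i * (1 - y i) := fun i => by fun_prop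
  calc ∫ ω, (∑ i, q i * x (t + 1) ω i) ^ 2 ∂μ
      = ∑ b : Fin N → Bool, ∫ ω in {ω | ∀ i, a t ω i = if b i then (1 : ℝ) else 0},
          (∑ i, q i * x (t + 1) ω i) ^ 2 ∂μ := by
        rw [← integral_iUnion_fintype (hRA.measurableSet_action t) (pairwise_disjoint_action a t)
          fun b => (hRA.integrable_comp_s2 (by omega : 1 ≤ t + 1)
            (g := fun y => (∑ i, q i * y i) ^ 2) (by fun_prop)).integrableOn,
          hRA.iUnion_action ht, setIntegral_univ]
    _ = ∑ b : Fin N → Bool, ∫ ω, (∏ i, if b i then x t ω i else 1 - x t ω i) *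
          (∑ i, q i * x t ω i
            + α * ∑ i, q i * ((if b i then 1 else 0) - x t ω i)) ^ 2 ∂μ := by
        refine Finset.sum_congr rfl fun b _ => ?_
        rw [← hRA.setIntegral_action ht b (hcg b)]
        refine setIntegral_congr_fun (hRA.measurableSet_action t b) fun ω hω => ?_
        have hω' : ∀ i, a t ω i = if b i then (1 : ℝ) else 0 := hω
        simp only [hstep, hω']
    _ = ∫ ω, ((∑ i, q i * x t ω i) ^ 2
          + α ^ 2 * ∑ i, q i ^ 2 * (x t ω i * (1 - x t ω i))) ∂μ := by
        rw [← integral_finsetSum _ fun b _ => hRA.integrable_comp_s2 ht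
          (g := fun y => (∏ i, if b i then y i else 1 - y i) *
            (∑ i, q i * y i + α * ∑ i, q i * ((if b i then 1 else 0) - y i)) ^ 2)
          ((hcw b).mul (hcg b))]
        simp only [sum_bernoulli_mul_sq]
    _ = _ := by
        rw [integral_add
          (hRA.integrable_comp_s2 ht (g := fun y => (∑ i, q i * y i) ^ 2) (by fun_prop))
          (hRA.integrable_comp_s2 ht (g := fun y => α ^ 2 * ∑ i, q i ^ 2 * (y i * (1 - y i)))
            (by fun_prop)), integral_const_mul,
          integral_finsetSum _ fun i _ => hRA.integrable_comp_s2 ht ((hvar i).const_mul (q i ^ 2))]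
        simp only [integral_const_mul]

lemma tendsto_integral_variance (hRA : IsRAModel μ α W x a) {q : Fin N → ℝ}
    (hq0 : ∀ i, 0 < q i) (hq : ∀ j, ∑ i, q i * W i j = q j) (i : Fin N) :
    Tendsto (fun t => ∫ ω, x t ω i * (1 - x t ω i) ∂μ) atTop (nhds 0) := by
  have := hRA.isProb
  have hα : 0 < α := hRA.alpha_mem.1
  set u : ℕ → ℝ := fun t => ∫ ω, (∑ i, q i * x (t + 1) ω i) ^ 2 ∂μ with hu
  have hnn : ∀ t j, 0 ≤ ∫ ω, x (t + 1) ω j * (1 - x (t + 1) ω j) ∂μ := by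
    intro t j
    refine integral_nonneg fun ω => ?_
    have := hRA.x_mem (t + 1) (by omega) ω j
    exact mul_nonneg this.1 (by linarith [this.2])
  have hdiff : ∀ t, u (t + 1) - u t
      = α ^ 2 * ∑ i, q i ^ 2 * ∫ ω, x (t + 1) ω i * (1 - x (t + 1) ω i) ∂μ := by
    intro t
    have := hRA.integral_sq_succ_s2 hq (by omega : 1 ≤ t + 1)
    simp only [hu, this]
    ring
  have hmono : Monotone u := by
    refine monotone_nat_of_le_succ fun t => ?_
    rw [← sub_nonneg, hdiff]
    exact mul_nonneg (sq_nonneg _)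
      (Finset.sum_nonneg fun j _ => mul_nonneg (sq_nonneg _) (hnn t j))
  have hbdd : BddAbove (Set.range u) := by
    refine ⟨(∑ i, q i) ^ 2, ?_⟩
    rintro _ ⟨t, rfl⟩
    calc u t ≤ ∫ _, (∑ i, q i) ^ 2 ∂μ := by
          refine integral_mono (hRA.integrable_comp_s2 (by omega : 1 ≤ t + 1)
            (g := fun y => (∑ i, q i * y i) ^ 2) (by fun_prop)) (integrable_const _) fun ω => ?_
          have hx := hRA.x_mem (t + 1) (by omega) ω
          refine pow_le_pow_left₀
            (Finset.sum_nonneg fun j _ => mul_nonneg (hq0 j).le (hx j).1) ?_ 2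
          exact Finset.sum_le_sum fun j _ => mul_le_of_le_one_right (hq0 j).le (hx j).2
      _ = _ := by simp
  have hlim := tendsto_atTop_ciSup hmono hbdd
  have hzero : Tendsto (fun t => u (t + 1) - u t) atTop (nhds 0) := by
    simpa using (hlim.comp (tendsto_add_atTop_nat 1)).sub hlim
  rw [← tendsto_add_atTop_iff_nat 1]
  have hc : 0 < α ^ 2 * q i ^ 2 := mul_pos (pow_pos hα 2) (pow_pos (hq0 i) 2)
  refine squeeze_zero (hnn · i) (fun t => ?_)
    (by simpa using hzero.div_const (α ^ 2 * q i ^ 2))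
  rw [le_div_iff₀ hc, hdiff]
  have hle := Finset.single_le_sum
    (f := fun j => q j ^ 2 * ∫ ω, x (t + 1) ω j * (1 - x (t + 1) ω j) ∂μ)
    (fun j _ => mul_nonneg (sq_nonneg _) (hnn t j)) (Finset.mem_univ i)
  nlinarith [mul_le_mul_of_nonneg_left hle (sq_nonneg α)]

lemma measurableSet_cti (hRA : IsRAModel μ α W x a) (δ : ℝ) (t : ℕ) (i : Fin N) :
    MeasurableSet (cti x δ t i) := by
  have hx : Measurable fun ω => x t ω i := (measurable_pi_apply i).comp (hRA.x_meas t)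
  exact (measurableSet_lt hx measurable_const).union (measurableSet_lt measurable_const hx)

/-- Markov's inequality for the time-`t` Bernoulli variance of agent `i`. -/
lemma measureReal_compl_cti_le (hRA : IsRAModel μ α W x a) {δ : ℝ}
    (hδ : δ ∈ Set.Ioo (0 : ℝ) (1 / 2)) {t : ℕ} (ht : 1 ≤ t) (i : Fin N) :
    μ.real (cti x δ t i)ᶜ ≤ (∫ ω, x t ω i * (1 - x t ω i) ∂μ) / (δ * (1 - δ)) := by
  have := hRA.isProb
  have hpos : 0 < δ * (1 - δ) := mul_pos hδ.1 (by linarith [hδ.2])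
  rw [le_div_iff₀' hpos]
  refine le_trans ?_ (mul_meas_ge_le_integral_of_nonneg (ae_of_all _ fun ω => ?_)
    (hRA.integrable_comp_s2 ht (g := fun y => y i * (1 - y i)) (by fun_prop)) (δ * (1 - δ)))
  · refine mul_le_mul_of_nonneg_left (measureReal_mono fun ω hω => ?_) hpos.le
    simp only [cti, Set.mem_compl_iff, Set.mem_ofPred_eq, not_or, not_lt] at hω ⊢
    nlinarith [mul_nonneg (sub_nonneg.mpr hω.1) (sub_nonneg.mpr hω.2)]
  · have := hRA.x_mem t ht ω i
    exact mul_nonneg this.1 (by linarith [this.2])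

end IsRAModel

theorem prob_ct_tendsto_one {Ω : Type*} [MeasurableSpace Ω] {N : ℕ} (hN : 1 ≤ N)
    (μ : Measure Ω) (α : ℝ) (W : Matrix (Fin N) (Fin N) ℝ)
    (x a : ℕ → Ω → Fin N → ℝ) (hRA : IsRAModel μ α W x a)
    (hirr : Irreducible W) :
    ∀ δ ∈ Set.Ioo (0 : ℝ) (1/2),
      Filter.Tendsto (fun t => (μ (ct x δ t)).toReal)
        Filter.atTop (nhds 1) := by
  intro δ hδ
  have := hRA.isProb
  obtain ⟨q, hq0, hq⟩ := exists_pos_stationary hN W hRA.W_nonneg hRA.W_rowsum hirr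
  have hmeas : ∀ t, MeasurableSet (ct x δ t) := fun t =>
    MeasurableSet.iInter fun i => hRA.measurableSet_cti δ t i
  have hbound : Tendsto
      (fun t => ∑ i, (∫ ω, x t ω i * (1 - x t ω i) ∂μ) / (δ * (1 - δ))) atTop (nhds 0) := by
    simpa using tendsto_finsetSum Finset.univ fun i _ =>
      (hRA.tendsto_integral_variance hq0 hq i).div_const (δ * (1 - δ))
  have hcompl : Tendsto (fun t => μ.real (ct x δ t)ᶜ) atTop (nhds 0) := by
    refine squeeze_zero' (Eventually.of_forall fun _ => measureReal_nonneg) ?_ hbound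
    filter_upwards [eventually_ge_atTop 1] with t ht
    rw [ct, Set.compl_iInter]
    exact (measureReal_iUnion_fintype_le _).trans
      (Finset.sum_le_sum fun i _ => hRA.measureReal_compl_cti_le hδ ht i)
  have hone : ∀ t, (μ (ct x δ t)).toReal = 1 - μ.real (ct x δ t)ᶜ := by
    intro t
    rw [probReal_compl_eq_one_sub (hmeas t), sub_sub_cancel]
    rfl
  simp only [hone]
  simpa using hcompl.const_sub 1

end RA
end

section
/- Under the RA model with W irreducible: for all ε > 0 and all δ ∈ (0,1/2) there exists a time t* such that for all t ≥ t*, P(C_t^𝟘(δ)) + P(C_t^𝟙(δ)) > 1 − ε; i.e., the RA model converges to consensus in probability: with probability approaching 1, at time t the whole vector x_t is δ-close either to the all-zeros corner or to the all-ones corner of [0,1]^N. -/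
open MeasureTheory ProbabilityTheory Filter

namespace RA

variable {Ω : Type*}

theorem exists_pos_left_eigenvector {N : ℕ} (hN : 1 ≤ N) {W : Matrix (Fin N) (Fin N) ℝ}
    (hW : ∀ i j, 0 ≤ W i j) (hrow : ∀ i, ∑ j, W i j = 1) (hirr : Irreducible W) :
    ∃ p : Fin N → ℝ, (∀ i, 0 < p i) ∧ ∀ j, ∑ i, p i * W i j = p j := by
  obtain ⟨v, hv0, hv⟩ : ∃ v : Fin N → ℝ, v ≠ 0 ∧ Matrix.vecMul v (W - 1) = 0 := by
    rw [Matrix.exists_vecMul_eq_zero_iff, ← Matrix.exists_mulVec_eq_zero_iff]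
    refine ⟨fun _ => 1, fun h => one_ne_zero (congrFun h ⟨0, hN⟩), ?_⟩
    ext i
    rw [Matrix.sub_mulVec, Matrix.one_mulVec]
    simp [Matrix.mulVec, dotProduct, hrow]
  have hvW : ∀ j, ∑ i, v i * W i j = v j := fun j => by
    have := congrFun hv j
    rw [Matrix.vecMul_sub, Matrix.vecMul_one] at this
    simpa [Matrix.vecMul, dotProduct, sub_eq_zero] using this
  have hle : ∀ j ∈ Finset.univ, |v j| ≤ ∑ i, |v i| * W i j := fun j _ => by
    conv_lhs => rw [← hvW j]
    refine (Finset.abs_sum_le_sum_abs _ _).trans (Finset.sum_le_sum fun i _ => ?_)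
    rw [abs_mul, abs_of_nonneg (hW i j)]
  have hsum : ∑ j, |v j| = ∑ j, ∑ i, |v i| * W i j := by
    rw [Finset.sum_comm]
    simp [← Finset.mul_sum, hrow]
  have heq : ∀ j, ∑ i, |v i| * W i j = |v j| := fun j =>
    ((Finset.sum_eq_sum_iff_of_le hle).1 hsum j (Finset.mem_univ j)).symm
  have hpow : ∀ n j, ∑ i, |v i| * (W ^ n) i j = |v j| := by
    have hvec : Matrix.vecMul (fun i => |v i|) W = fun i => |v i| := funext heq
    intro n
    have : Matrix.vecMul (fun i => |v i|) (W ^ n) = fun i => |v i| := by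
      induction n with
      | zero => simp
      | succ n ih => rw [pow_succ, ← Matrix.vecMul_vecMul, ih, hvec]
    exact fun j => congrFun this j
  have hpn : ∀ n i j, 0 ≤ (W ^ n) i j := by
    intro n
    induction n with
    | zero => intro i j; rw [pow_zero, Matrix.one_apply]; split_ifs <;> norm_num
    | succ n ih =>
      intro i j
      rw [pow_succ, Matrix.mul_apply]
      exact Finset.sum_nonneg fun k _ => mul_nonneg (ih _ _) (hW _ _)
  obtain ⟨i, hi⟩ := Function.ne_iff.1 hv0
  refine ⟨fun i => |v i|, fun j => ?_, heq⟩
  obtain ⟨n, hn⟩ := hirr i j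
  change 0 < |v j|
  rw [← hpow n j]
  exact Finset.sum_pos' (fun k _ => mul_nonneg (abs_nonneg _) (hpn _ _ _))
    ⟨i, Finset.mem_univ i, mul_pos (abs_pos.2 hi) hn⟩

theorem sum_bernoulli_weights {N : ℕ} (S : Finset (Fin N)) (y : Fin N → ℝ) :
    ∑ b : Fin N → Bool, (if ∀ k ∈ S, b k = true then (1 : ℝ) else 0) *
      ∏ i, (if b i then y i else 1 - y i) = ∏ k ∈ S, y k := by
  have h1 : ∀ b : Fin N → Bool, (if ∀ k ∈ S, b k = true then (1 : ℝ) else 0) *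
      ∏ i, (if b i then y i else 1 - y i) =
      ∏ i, (if b i then y i else if i ∈ S then 0 else 1 - y i) := by
    intro b
    split_ifs with h
    · rw [one_mul]
      refine Finset.prod_congr rfl fun i _ => ?_
      by_cases hi : i ∈ S
      · simp [h i hi]
      · simp [hi]
    · push Not at h
      obtain ⟨k, hk, hbk⟩ := h
      rw [zero_mul, Finset.prod_eq_zero (Finset.mem_univ k)]
      simp [hbk, hk]
  rw [Finset.sum_congr rfl fun b _ => h1 b]
  have h2 := Finset.prod_univ_sum (fun _ : Fin N => (Finset.univ : Finset Bool))
    (fun i b => if b then y i else if i ∈ S then 0 else 1 - y i)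
  rw [Fintype.piFinset_univ] at h2
  rw [← h2, ← Finset.prod_subset (Finset.subset_univ S)]
  · refine Finset.prod_congr rfl fun i hi => ?_
    simp [hi]
  · intro i _ hi
    simp [hi]

theorem prod_eq_sum_indicator {N : ℕ} (S : Finset (Fin N)) {c : Fin N → ℝ}
    (hc : ∀ i, c i = 0 ∨ c i = 1) :
    ∏ k ∈ S, c k = ∑ b : Fin N → Bool, (if ∀ k ∈ S, b k = true then (1 : ℝ) else 0) *
      (if ∀ i, c i = if b i then (1 : ℝ) else 0 then 1 else 0) := by
  classical
  rw [Finset.sum_eq_single (fun i => decide (c i = 1))]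
  · rw [if_pos (c := ∀ i, c i = _), mul_one]
    · split_ifs with h
      · exact Finset.prod_eq_one fun i hi => by simpa using h i hi
      · push Not at h
        obtain ⟨k, hk, hk'⟩ := h
        exact Finset.prod_eq_zero hk ((hc k).resolve_right (by simpa using hk'))
    · intro i
      rcases hc i with h | h <;> simp [h]
  · intro b _ hb
    rw [if_neg (c := ∀ i, c i = _), mul_zero]
    intro h
    apply hb
    funext i
    have := h i
    cases hbi : b i <;> simp [hbi] at this <;> simp [this]
  · simp

section Moments

variable {Ω : Type*} [mΩ : MeasurableSpace Ω] {N : ℕ} {μ : Measure Ω} {α : ℝ}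
  {W : Matrix (Fin N) (Fin N) ℝ} {x a : ℕ → Ω → Fin N → ℝ}

theorem hist_le (hRA : IsRAModel μ α W x a) (t : ℕ) : hist x a t ≤ mΩ :=
  sup_le (iSup₂_le fun s _ => (hRA.x_meas s).comap_le)
    (iSup₂_le fun s _ => (hRA.a_meas s).comap_le)

theorem measurable_x_apply (hRA : IsRAModel μ α W x a) (t : ℕ) (i : Fin N) :
    Measurable fun ω => x t ω i :=
  (measurable_pi_apply i).comp (hRA.x_meas t)

theorem measurable_a_apply (hRA : IsRAModel μ α W x a) (t : ℕ) (i : Fin N) :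
    Measurable fun ω => a t ω i :=
  (measurable_pi_apply i).comp (hRA.a_meas t)

theorem measurable_hist_x_apply {t : ℕ} (ht : 1 ≤ t) (i : Fin N) :
    Measurable[hist x a t] fun ω => x t ω i := by
  have h1 : Measurable[MeasurableSpace.comap (x t) inferInstance] (x t) :=
    comap_measurable _
  have h2 : MeasurableSpace.comap (x t) inferInstance ≤ hist x a t :=
    le_sup_of_le_left (le_iSup₂_of_le (f := fun s (_ : s ∈ Finset.Icc 1 t) =>
      MeasurableSpace.comap (x s) inferInstance) t (by simp [ht]) le_rfl)
  exact (measurable_pi_apply i).comp (h1.mono h2 le_rfl)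

theorem memLp_x (hRA : IsRAModel μ α W x a) {t : ℕ} (ht : 1 ≤ t) (i : Fin N) :
    MemLp (fun ω => x t ω i) ⊤ μ :=
  memLp_top_of_bound (measurable_x_apply hRA t i).aestronglyMeasurable 1
    (Eventually.of_forall fun ω => by
      have := hRA.x_mem t ht ω i
      rw [Real.norm_eq_abs, abs_le]
      constructor <;> linarith [this.1, this.2])

theorem memLp_a (hRA : IsRAModel μ α W x a) {t : ℕ} (ht : 1 ≤ t) (i : Fin N) :
    MemLp (fun ω => a t ω i) ⊤ μ :=
  memLp_top_of_bound (measurable_a_apply hRA t i).aestronglyMeasurable 1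
    (Eventually.of_forall fun ω => by
      rcases hRA.a_mem t ht ω i with h | h <;> simp [h])

theorem condExp_prod_a (hRA : IsRAModel μ α W x a) {t : ℕ} (ht : 1 ≤ t)
    (S : Finset (Fin N)) :
    (fun ω => ∏ k ∈ S, x t ω k) =ᵐ[μ] μ[fun ω => ∏ k ∈ S, a t ω k | hist x a t] := by
  have := hRA.isProb
  have hxint : Integrable (fun ω => ∏ k ∈ S, x t ω k) μ :=
    (MemLp.prod' (p := fun _ => ⊤) fun k _ => memLp_x hRA ht k).integrable (by simp)
  have haint : Integrable (fun ω => ∏ k ∈ S, a t ω k) μ :=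
    (MemLp.prod' (p := fun _ => ⊤) fun k _ => memLp_a hRA ht k).integrable (by simp)
  refine ae_eq_condExp_of_forall_setIntegral_eq (hist_le hRA t) haint
    (fun _ _ _ => hxint.integrableOn) ?_ ?_
  · intro H hH _
    have hmeas : ∀ b : Fin N → Bool,
        MeasurableSet {ω | ∀ i, a t ω i = if b i then (1 : ℝ) else 0} := fun b => by
      rw [Set.ofPred_forall]
      exact MeasurableSet.iInter fun i =>
        measurableSet_eq_fun (measurable_a_apply hRA t i) measurable_const
    have hw : ∀ b : Fin N → Bool,
        Integrable (fun ω => ∏ i, (if b i then x t ω i else 1 - x t ω i)) μ := fun b => by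
      refine (MemLp.prod' (p := fun _ => ⊤) (s := Finset.univ)
        (f := fun i ω => if b i then x t ω i else 1 - x t ω i) fun i _ => ?_).integrable
        (by simp)
      cases b i
      · exact (memLp_const (1 : ℝ)).sub (memLp_x hRA ht i)
      · simpa using memLp_x hRA ht i
    have hind : ∀ b : Fin N → Bool,
        (fun ω => if ∀ i, a t ω i = if b i then (1 : ℝ) else 0 then (1 : ℝ) else 0) =
        Set.indicator {ω | ∀ i, a t ω i = if b i then (1 : ℝ) else 0} (fun _ => 1) := fun b => by
      ext ω
      simp [Set.indicator_apply]
    have hi : ∀ b : Fin N → Bool, Integrable (fun ω => if ∀ i, a t ω i = if b i then (1 : ℝ)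
        else 0 then (1 : ℝ) else 0) μ := fun b => by
      rw [hind b]
      exact (integrable_const (1 : ℝ)).indicator (hmeas b)
    simp_rw [fun ω => prod_eq_sum_indicator S (hRA.a_mem t ht ω), ← sum_bernoulli_weights S]
    rw [integral_finsetSum _ fun b _ => ((hw b).const_mul _).integrableOn,
      integral_finsetSum _ fun b _ => ((hi b).const_mul _).integrableOn]
    refine Finset.sum_congr rfl fun b _ => ?_
    rw [integral_const_mul, integral_const_mul, ← hRA.bernoulli t ht b H hH]
    congr 1
    rw [hind b, setIntegral_indicator (hmeas b), setIntegral_const]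
    simp [Measure.real]
  · exact (Finset.measurable_fun_prod S fun k _ =>
      measurable_hist_x_apply ht k).stronglyMeasurable.aestronglyMeasurable

theorem integral_mul_prod_a (hRA : IsRAModel μ α W x a) {t : ℕ} (ht : 1 ≤ t)
    (S : Finset (Fin N)) {g : Ω → ℝ} (hg : Measurable[hist x a t] g) (hg' : MemLp g ⊤ μ) :
    ∫ ω, g ω * ∏ k ∈ S, a t ω k ∂μ = ∫ ω, g ω * ∏ k ∈ S, x t ω k ∂μ := by
  have := hRA.isProb
  have ha : MemLp (fun ω => ∏ k ∈ S, a t ω k) ⊤ μ := by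
    simpa using MemLp.prod' (p := fun _ => ⊤) fun k (_ : k ∈ S) => memLp_a hRA ht k
  have hprod : Integrable (g * fun ω => ∏ k ∈ S, a t ω k) μ :=
    (ha.mul (r := ⊤) hg').integrable le_top
  have h1 := condExp_mul_of_stronglyMeasurable_left hg.stronglyMeasurable hprod
    (ha.integrable le_top)
  calc ∫ ω, g ω * ∏ k ∈ S, a t ω k ∂μ
      = ∫ ω, (μ[g * fun ω => ∏ k ∈ S, a t ω k | hist x a t]) ω ∂μ :=
        (integral_condExp (hist_le hRA t)).symm
    _ = ∫ ω, g ω * ∏ k ∈ S, x t ω k ∂μ := by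
        refine integral_congr_ae ?_
        filter_upwards [h1, condExp_prod_a hRA ht S] with ω h1 h2
        rw [h1, Pi.mul_apply, h2]

theorem integral_mul_a (hRA : IsRAModel μ α W x a) {t : ℕ} (ht : 1 ≤ t) (i : Fin N)
    {g : Ω → ℝ} (hg : Measurable[hist x a t] g) (hg' : MemLp g ⊤ μ) :
    ∫ ω, g ω * a t ω i ∂μ = ∫ ω, g ω * x t ω i ∂μ := by
  simpa using integral_mul_prod_a hRA ht {i} hg hg'

theorem memLp_top_mul {f g : Ω → ℝ} (hf : MemLp f ⊤ μ) (hg : MemLp g ⊤ μ) :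
    MemLp (fun ω => f ω * g ω) ⊤ μ :=
  hg.mul (r := ⊤) hf

theorem integrable_fun_sub {f g : Ω → ℝ} (hf : Integrable f μ) (hg : Integrable g μ) :
    Integrable (fun ω => f ω - g ω) μ :=
  hf.sub hg

theorem integral_noise_mul_noise (hRA : IsRAModel μ α W x a) {t : ℕ} (ht : 1 ≤ t)
    (i j : Fin N) :
    ∫ ω, (a t ω i - x t ω i) * (a t ω j - x t ω j) ∂μ =
      if i = j then ∫ ω, x t ω i * (1 - x t ω i) ∂μ else 0 := by
  have := hRA.isProb
  have hx := memLp_x hRA ht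
  have ha := memLp_a hRA ht
  have hmulInt : ∀ {f g : Ω → ℝ}, MemLp f ⊤ μ → MemLp g ⊤ μ → Integrable (fun ω => f ω * g ω) μ :=
    fun hf hg => (memLp_top_mul hf hg).integrable le_top
  have hxa : ∀ k l, ∫ ω, x t ω k * a t ω l ∂μ = ∫ ω, x t ω k * x t ω l ∂μ := fun k l =>
    integral_mul_a hRA ht l (measurable_hist_x_apply ht k) (hx k)
  have hexp : ∫ ω, (a t ω i - x t ω i) * (a t ω j - x t ω j) ∂μ =
      ∫ ω, a t ω i * a t ω j ∂μ - ∫ ω, x t ω i * x t ω j ∂μ := by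
    have : ∀ ω, (a t ω i - x t ω i) * (a t ω j - x t ω j) = a t ω i * a t ω j -
        x t ω i * a t ω j - x t ω j * a t ω i + x t ω i * x t ω j := fun ω => by ring
    simp_rw [this]
    rw [integral_add (integrable_fun_sub (integrable_fun_sub (hmulInt (ha i) (ha j)) (hmulInt (hx i) (ha j)))
      (hmulInt (hx j) (ha i))) (hmulInt (hx i) (hx j)),
      integral_sub (integrable_fun_sub (hmulInt (ha i) (ha j)) (hmulInt (hx i) (ha j))) (hmulInt (hx j) (ha i)),
      integral_sub (hmulInt (ha i) (ha j)) (hmulInt (hx i) (ha j)), hxa, hxa]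
    simp_rw [fun ω => mul_comm (x t ω j) (x t ω i)]
    ring
  rw [hexp]
  split_ifs with h
  · subst h
    have h1 : ∀ ω, a t ω i * a t ω i = 1 * a t ω i := fun ω => by
      rcases hRA.a_mem t ht ω i with h | h <;> simp [h]
    simp_rw [h1]
    rw [integral_mul_a hRA ht i measurable_const (memLp_const 1),
      ← integral_sub (hmulInt (memLp_const 1) (hx i)) (hmulInt (hx i) (hx i))]
    exact integral_congr_ae (Eventually.of_forall fun ω => by ring)
  · have h2 := integral_mul_prod_a hRA ht {i, j} (g := fun _ => 1) measurable_const
      (memLp_const 1)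
    simp only [one_mul, Finset.prod_pair h] at h2
    rw [h2, sub_self]

theorem memLp_noise (hRA : IsRAModel μ α W x a) {t : ℕ} (ht : 1 ≤ t) (c : Fin N → ℝ) :
    MemLp (fun ω => ∑ j, c j * (a t ω j - x t ω j)) ⊤ μ :=
  memLp_finsetSum _ fun j _ => ((memLp_a hRA ht j).sub (memLp_x hRA ht j)).const_mul (c j)

theorem integral_mul_noise (hRA : IsRAModel μ α W x a) {t : ℕ} (ht : 1 ≤ t)
    (c : Fin N → ℝ) {g : Ω → ℝ} (hg : Measurable[hist x a t] g) (hg' : MemLp g ⊤ μ) :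
    ∫ ω, g ω * ∑ j, c j * (a t ω j - x t ω j) ∂μ = 0 := by
  have := hRA.isProb
  have hmulInt : ∀ {f h : Ω → ℝ}, MemLp f ⊤ μ → MemLp h ⊤ μ → Integrable (fun ω => f ω * h ω) μ :=
    fun hf hg => (memLp_top_mul hf hg).integrable le_top
  have h1 : ∀ ω, g ω * ∑ j, c j * (a t ω j - x t ω j) =
      ∑ j, c j * (g ω * a t ω j - g ω * x t ω j) := fun ω => by
    rw [Finset.mul_sum]
    exact Finset.sum_congr rfl fun j _ => by ring
  simp_rw [h1]
  rw [integral_finsetSum _ fun j _ =>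
    (integrable_fun_sub (hmulInt hg' (memLp_a hRA ht j)) (hmulInt hg' (memLp_x hRA ht j))).const_mul (c j)]
  refine Finset.sum_eq_zero fun j _ => ?_
  rw [integral_const_mul, integral_sub (hmulInt hg' (memLp_a hRA ht j))
    (hmulInt hg' (memLp_x hRA ht j)), integral_mul_a hRA ht j hg hg', sub_self, mul_zero]

theorem integral_sq_add_noise (hRA : IsRAModel μ α W x a) {t : ℕ} (ht : 1 ≤ t)
    (c : Fin N → ℝ) {g : Ω → ℝ} (hg : Measurable[hist x a t] g) (hg' : MemLp g ⊤ μ) :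
    ∫ ω, (g ω + ∑ j, c j * (a t ω j - x t ω j)) ^ 2 ∂μ =
      ∫ ω, g ω ^ 2 ∂μ + ∑ j, c j ^ 2 * ∫ ω, x t ω j * (1 - x t ω j) ∂μ := by
  have := hRA.isProb
  have hmulInt : ∀ {f h : Ω → ℝ}, MemLp f ⊤ μ → MemLp h ⊤ μ → Integrable (fun ω => f ω * h ω) μ :=
    fun hf hg => (memLp_top_mul hf hg).integrable le_top
  have hn := memLp_noise hRA ht c
  have hd : ∀ i, MemLp (fun ω => a t ω i - x t ω i) ⊤ μ := fun i =>
    (memLp_a hRA ht i).sub (memLp_x hRA ht i)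
  have h1 : ∀ ω, (g ω + ∑ j, c j * (a t ω j - x t ω j)) ^ 2 =
      g ω * g ω + 2 * (g ω * ∑ j, c j * (a t ω j - x t ω j)) +
      ∑ i, ∑ j, c i * c j * ((a t ω i - x t ω i) * (a t ω j - x t ω j)) := fun ω => by
    have : ∑ i, ∑ j, c i * c j * ((a t ω i - x t ω i) * (a t ω j - x t ω j)) =
        (∑ j, c j * (a t ω j - x t ω j)) * ∑ j, c j * (a t ω j - x t ω j) := by
      rw [Finset.sum_mul_sum]
      exact Finset.sum_congr rfl fun i _ => Finset.sum_congr rfl fun j _ => by ring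
    rw [this]
    ring
  have h2 : ∀ i, Integrable
      (fun ω => ∑ j, c i * c j * ((a t ω i - x t ω i) * (a t ω j - x t ω j))) μ := fun i =>
    integrable_finsetSum _ fun j _ => (hmulInt (hd i) (hd j)).const_mul _
  simp_rw [h1]
  rw [integral_add ((hmulInt hg' hg').fun_add ((hmulInt hg' hn).const_mul 2))
      (integrable_finsetSum _ fun i _ => h2 i),
    integral_add (hmulInt hg' hg') ((hmulInt hg' hn).const_mul 2), integral_const_mul,
    integral_mul_noise hRA ht c hg hg', integral_finsetSum _ fun i _ => h2 i]
  simp_rw [integral_finsetSum Finset.univ fun j _ => (hmulInt (hd _) (hd j)).const_mul (c _ * c j),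
    integral_const_mul, integral_noise_mul_noise hRA ht]
  simp [pow_two]

end Moments

section Limits

variable {Ω : Type*} [mΩ : MeasurableSpace Ω] {N : ℕ} {μ : Measure Ω} {α : ℝ}
  {W : Matrix (Fin N) (Fin N) ℝ} {x a : ℕ → Ω → Fin N → ℝ}

theorem x_mul_one_sub_nonneg (hRA : IsRAModel μ α W x a) {t : ℕ} (ht : 1 ≤ t) (i : Fin N)
    (ω : Ω) : 0 ≤ x t ω i * (1 - x t ω i) :=
  mul_nonneg (hRA.x_mem t ht ω i).1 (sub_nonneg.2 (hRA.x_mem t ht ω i).2)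

theorem memLp_weighted_sum (hRA : IsRAModel μ α W x a) {t : ℕ} (ht : 1 ≤ t) (c : Fin N → ℝ) :
    MemLp (fun ω => ∑ j, c j * x t ω j) ⊤ μ :=
  memLp_finsetSum _ fun j _ => (memLp_x hRA ht j).const_mul (c j)

theorem measurable_hist_weighted_sum {t : ℕ} (ht : 1 ≤ t) (c : Fin N → ℝ) :
    Measurable[hist x a t] fun ω => ∑ j, c j * x t ω j :=
  Finset.measurable_fun_sum _ fun j _ => (measurable_hist_x_apply ht j).const_mul (c j)

theorem tendsto_integral_x_mul_one_sub (hN : 1 ≤ N) (hRA : IsRAModel μ α W x a)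
    (hirr : Irreducible W) (i : Fin N) :
    Tendsto (fun t => ∫ ω, x t ω i * (1 - x t ω i) ∂μ) atTop (nhds 0) := by
  have := hRA.isProb
  obtain ⟨p, hp, hpW⟩ := exists_pos_left_eigenvector hN hRA.W_nonneg hRA.W_rowsum hirr
  have hα := hRA.alpha_mem.1
  set Q : ℕ → ℝ := fun n => ∫ ω, (∑ j, p j * x (n + 1) ω j) ^ 2 ∂μ with hQ
  set F : ℕ → Fin N → ℝ := fun n j => ∫ ω, x (n + 1) ω j * (1 - x (n + 1) ω j) ∂μ with hF
  have hF0 : ∀ n j, 0 ≤ F n j := fun n j =>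
    integral_nonneg fun ω => x_mul_one_sub_nonneg hRA (Nat.le_add_left 1 n) j ω
  have hstep : ∀ n, Q (n + 1) = Q n + ∑ j, (α * p j) ^ 2 * F n j := fun n => by
    have ht : 1 ≤ n + 1 := Nat.le_add_left 1 n
    have h := integral_sq_add_noise hRA ht (fun j => α * p j)
      (measurable_hist_weighted_sum ht p) (memLp_weighted_sum hRA ht p)
    rw [hQ, hF, ← h]
    refine integral_congr_ae (Eventually.of_forall fun ω => ?_)
    have hexch : ∑ j, p j * ∑ k, W j k * a (n + 1) ω k = ∑ k, p k * a (n + 1) ω k := by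
      simp_rw [Finset.mul_sum]
      rw [Finset.sum_comm]
      refine Finset.sum_congr rfl fun k _ => ?_
      rw [← hpW k, Finset.sum_mul]
      exact Finset.sum_congr rfl fun j _ => by ring
    simp_rw [hRA.update (n + 1) ht ω]
    have h1 : ∑ j, p j * ((1 - α) * x (n + 1) ω j + α * ∑ k, W j k * a (n + 1) ω k) =
        (1 - α) * ∑ j, p j * x (n + 1) ω j + α * ∑ k, p k * a (n + 1) ω k := by
      rw [← hexch, Finset.mul_sum, Finset.mul_sum, ← Finset.sum_add_distrib]
      exact Finset.sum_congr rfl fun j _ => by ring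
    have h2 : ∑ j, α * p j * (a (n + 1) ω j - x (n + 1) ω j) =
        α * ∑ k, p k * a (n + 1) ω k - α * ∑ j, p j * x (n + 1) ω j := by
      rw [Finset.mul_sum, Finset.mul_sum, ← Finset.sum_sub_distrib]
      exact Finset.sum_congr rfl fun j _ => by ring
    rw [h1, h2]
    ring
  have hterm : ∀ n j, 0 ≤ (α * p j) ^ 2 * F n j := fun n j =>
    mul_nonneg (sq_nonneg _) (hF0 n j)
  have hmono : Monotone Q := monotone_nat_of_le_succ fun n => by
    rw [hstep n]
    exact le_add_of_nonneg_right (Finset.sum_nonneg fun j _ => hterm n j)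
  have hbdd : BddAbove (Set.range Q) := by
    refine ⟨(∑ j, p j) ^ 2, ?_⟩
    rintro _ ⟨n, rfl⟩
    have ht : 1 ≤ n + 1 := Nat.le_add_left 1 n
    have hi : Integrable (fun ω => (∑ j, p j * x (n + 1) ω j) ^ 2) μ := by
      simp_rw [pow_two]
      exact (memLp_top_mul (memLp_weighted_sum hRA ht p)
        (memLp_weighted_sum hRA ht p)).integrable le_top
    have := integral_mono (μ := μ) hi (integrable_const ((∑ j, p j) ^ 2)) fun ω => by
      refine pow_le_pow_left₀ (Finset.sum_nonneg fun j _ =>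
        mul_nonneg (hp j).le (hRA.x_mem _ ht ω j).1) (Finset.sum_le_sum fun j _ => ?_) 2
      exact mul_le_of_le_one_right (hp j).le (hRA.x_mem _ ht ω j).2
    simpa using this
  have hlim := tendsto_atTop_ciSup hmono hbdd
  have hdiff : Tendsto (fun n => (Q (n + 1) - Q n) / (α * p i) ^ 2) atTop (nhds 0) := by
    simpa using (((tendsto_add_atTop_iff_nat 1).2 hlim).sub hlim).div_const ((α * p i) ^ 2)
  rw [← tendsto_add_atTop_iff_nat 1]
  refine squeeze_zero (fun n => hF0 n i) (fun n => ?_) hdiff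
  rw [le_div_iff₀ (pow_pos (mul_pos hα (hp i)) 2), hstep n, add_sub_cancel_left, mul_comm]
  exact Finset.single_le_sum (fun j _ => hterm n j) (Finset.mem_univ i)

theorem mul_sq_sub_le_variance {c : Fin N → ℝ} (hc : ∀ j, 0 ≤ c j) (hsum : ∑ j, c j = 1)
    {y : Fin N → ℝ} (hy : ∀ j, y j ∈ Set.Icc (0 : ℝ) 1) (hα : α ∈ Set.Ioo (0 : ℝ) 1)
    (i j : Fin N) :
    α * (1 - α) * c j * (y i - y j) ^ 2 ≤
      2 * (((1 - α) * y i + α * ∑ k, c k * y k) * (1 - ((1 - α) * y i + α * ∑ k, c k * y k))) := by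
  obtain ⟨hα0, hα1⟩ := hα
  set s := ∑ k, c k * y k with hs
  have hsingle : c j * (y j - s) ^ 2 ≤ ∑ k, c k * (y k - s) ^ 2 :=
    Finset.single_le_sum (f := fun k => c k * (y k - s) ^ 2)
      (fun k _ => mul_nonneg (hc k) (sq_nonneg _)) (Finset.mem_univ j)
  have hnn : 0 ≤ ∑ k, c k * (y k * (1 - y k)) := Finset.sum_nonneg fun k _ =>
    mul_nonneg (hc k) (mul_nonneg (hy k).1 (sub_nonneg.2 (hy k).2))
  have hdecomp : s * (1 - s) = ∑ k, c k * (y k * (1 - y k)) + ∑ k, c k * (y k - s) ^ 2 := by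
    have : ∀ k, c k * (y k * (1 - y k)) + c k * (y k - s) ^ 2 =
        (1 - 2 * s) * (c k * y k) + s ^ 2 * c k := fun k => by ring
    rw [← Finset.sum_add_distrib]
    simp_rw [this]
    rw [Finset.sum_add_distrib, ← Finset.mul_sum, ← Finset.mul_sum, hsum, ← hs]
    ring
  have hcj : c j ≤ 1 := hsum ▸ Finset.single_le_sum (fun k _ => hc k) (Finset.mem_univ j)
  have hyi : 0 ≤ y i * (1 - y i) := mul_nonneg (hy i).1 (sub_nonneg.2 (hy i).2)
  have h1 : ((1 - α) * y i + α * s) * (1 - ((1 - α) * y i + α * s)) =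
      (1 - α) * (y i * (1 - y i)) + α * (s * (1 - s)) + α * (1 - α) * (y i - s) ^ 2 := by ring
  have hβ : 0 < 1 - α := sub_pos.2 hα1
  have h2 : α * (1 - α) * (c j * (y j - s) ^ 2) ≤ α * (s * (1 - s)) := by
    have hle : c j * (y j - s) ^ 2 ≤ s * (1 - s) := by linarith
    have h0 : 0 ≤ c j * (y j - s) ^ 2 := mul_nonneg (hc j) (sq_nonneg _)
    rw [mul_assoc]
    refine mul_le_mul_of_nonneg_left ?_ hα0.le
    nlinarith
  have h3 : α * (1 - α) * (c j * (y i - s) ^ 2) ≤ α * (1 - α) * (y i - s) ^ 2 := by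
    refine mul_le_mul_of_nonneg_left ?_ (mul_pos hα0 hβ).le
    exact mul_le_of_le_one_left (sq_nonneg _) hcj
  have h4 : (y i - y j) ^ 2 ≤ 2 * (y i - s) ^ 2 + 2 * (y j - s) ^ 2 := by
    nlinarith [sq_nonneg ((y i - s) + (y j - s))]
  have h5 := mul_le_mul_of_nonneg_left h4 (mul_nonneg (mul_pos hα0 hβ).le (hc j))
  have h6 : 0 ≤ (1 - α) * (y i * (1 - y i)) := mul_nonneg hβ.le hyi
  rw [h1]
  linarith

theorem tendsto_integral_drift_mul_one_sub (hN : 1 ≤ N) (hRA : IsRAModel μ α W x a)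
    (hirr : Irreducible W) (i : Fin N) :
    Tendsto (fun t => ∫ ω, ((1 - α) * x t ω i + α * ∑ k, W i k * x t ω k) *
      (1 - ((1 - α) * x t ω i + α * ∑ k, W i k * x t ω k)) ∂μ) atTop (nhds 0) := by
  have := hRA.isProb
  have hF := tendsto_integral_x_mul_one_sub hN hRA hirr
  have hlim : Tendsto (fun t => ∫ ω, x (t + 1) ω i * (1 - x (t + 1) ω i) ∂μ +
      ∑ j, (α * W i j) ^ 2 * ∫ ω, x t ω j * (1 - x t ω j) ∂μ) atTop (nhds 0) := by
    have h := ((tendsto_add_atTop_iff_nat 1).2 (hF i)).add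
      (tendsto_finsetSum Finset.univ fun j _ => (hF j).const_mul ((α * W i j) ^ 2))
    simpa using h
  refine hlim.congr' ?_
  filter_upwards [eventually_ge_atTop 1] with t ht
  set g : Ω → ℝ := fun ω => (1 - α) * x t ω i + α * ∑ k, W i k * x t ω k with hgdef
  have hg : Measurable[hist x a t] g :=
    ((measurable_hist_x_apply ht i).const_mul _).add
      ((measurable_hist_weighted_sum ht (W i)).const_mul _)
  have hg' : MemLp g ⊤ μ :=
    ((memLp_x hRA ht i).const_mul _).add ((memLp_weighted_sum hRA ht (W i)).const_mul _)
  have hnext : ∀ ω, x (t + 1) ω i = g ω + ∑ j, α * W i j * (a t ω j - x t ω j) := fun ω => by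
    have h2 : ∑ j, α * W i j * (a t ω j - x t ω j) =
        α * ∑ k, W i k * a t ω k - α * ∑ j, W i j * x t ω j := by
      rw [Finset.mul_sum, Finset.mul_sum, ← Finset.sum_sub_distrib]
      exact Finset.sum_congr rfl fun j _ => by ring
    rw [hRA.update t ht ω i, h2, hgdef]
    ring
  have hsq := integral_sq_add_noise hRA ht (fun j => α * W i j) hg hg'
  have hmean := integral_mul_noise hRA ht (fun j => α * W i j) (g := fun _ => 1)
    measurable_const (memLp_const 1)
  have hn := memLp_noise hRA ht fun j => α * W i j
  have hx1 := memLp_x hRA (Nat.le_add_left 1 t) i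
  simp_rw [one_mul] at hmean
  simp_rw [← hnext] at hsq
  have hE : ∫ ω, x (t + 1) ω i ∂μ = ∫ ω, g ω ∂μ := by
    simp_rw [hnext]
    rw [integral_add (hg'.integrable le_top) (hn.integrable le_top), hmean, add_zero]
  have hsplit : ∀ {f : Ω → ℝ}, MemLp f ⊤ μ →
      ∫ ω, f ω * (1 - f ω) ∂μ = ∫ ω, f ω ∂μ - ∫ ω, f ω ^ 2 ∂μ := fun {f} hf => by
    have hi : Integrable (fun ω => f ω ^ 2) μ := by
      simp_rw [pow_two]
      exact (memLp_top_mul hf hf).integrable le_top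
    rw [← integral_sub (hf.integrable le_top) hi]
    exact integral_congr_ae (Eventually.of_forall fun ω => by ring)
  change _ = ∫ ω, g ω * (1 - g ω) ∂μ
  rw [hsplit hx1, hsplit hg', hE, hsq]
  ring

theorem integrable_sq_sub (hRA : IsRAModel μ α W x a) {t : ℕ} (ht : 1 ≤ t) (i j : Fin N) :
    Integrable (fun ω => (x t ω i - x t ω j) ^ 2) μ := by
  have := hRA.isProb
  have h := (memLp_x hRA ht i).sub (memLp_x hRA ht j)
  simp_rw [pow_two]
  exact (memLp_top_mul h h).integrable le_top

theorem tendsto_integral_sq_sub_of_edge (hN : 1 ≤ N) (hRA : IsRAModel μ α W x a)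
    (hirr : Irreducible W) {i j : Fin N} (hij : 0 < W i j) :
    Tendsto (fun t => ∫ ω, (x t ω i - x t ω j) ^ 2 ∂μ) atTop (nhds 0) := by
  have := hRA.isProb
  have hc : 0 < α * (1 - α) * W i j :=
    mul_pos (mul_pos hRA.alpha_mem.1 (sub_pos.2 hRA.alpha_mem.2)) hij
  have hlim := ((tendsto_integral_drift_mul_one_sub hN hRA hirr i).const_mul 2).div_const
    (α * (1 - α) * W i j)
  simp only [mul_zero, zero_div] at hlim
  refine squeeze_zero' (Eventually.of_forall fun t => integral_nonneg fun ω => sq_nonneg _)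
    ?_ hlim
  filter_upwards [eventually_ge_atTop 1] with t ht
  rw [le_div_iff₀ hc, mul_comm, ← integral_const_mul, ← integral_const_mul]
  have hg : MemLp (fun ω => (1 - α) * x t ω i + α * ∑ k, W i k * x t ω k) ⊤ μ :=
    ((memLp_x hRA ht i).const_mul _).add ((memLp_weighted_sum hRA ht (W i)).const_mul _)
  refine integral_mono ((integrable_sq_sub hRA ht i j).const_mul _)
    (((memLp_top_mul hg ((memLp_const 1).sub hg)).integrable le_top).const_mul 2) fun ω => ?_
  exact mul_sq_sub_le_variance (hRA.W_nonneg i) (hRA.W_rowsum i) (hRA.x_mem t ht ω)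
    hRA.alpha_mem i j

theorem tendsto_integral_sq_sub (hN : 1 ≤ N) (hRA : IsRAModel μ α W x a)
    (hirr : Irreducible W) (i j : Fin N) :
    Tendsto (fun t => ∫ ω, (x t ω i - x t ω j) ^ 2 ∂μ) atTop (nhds 0) := by
  have hpow : ∀ n j, 0 < (W ^ n) i j →
      Tendsto (fun t => ∫ ω, (x t ω i - x t ω j) ^ 2 ∂μ) atTop (nhds 0) := by
    intro n
    induction n with
    | zero =>
      intro j hj
      have : i = j := by
        by_contra h
        simp [h] at hj
      subst this
      simp
    | succ n ih =>
      intro j hj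
      rw [pow_succ, Matrix.mul_apply] at hj
      obtain ⟨k, -, hk⟩ := Finset.exists_lt_of_sum_lt (s := Finset.univ)
        (f := fun _ : Fin N => (0 : ℝ)) (by simpa using hj)
      have hkj : 0 < W k j := (hRA.W_nonneg k j).lt_of_ne fun h => by simp [← h] at hk
      have hik : 0 < (W ^ n) i k := pos_of_mul_pos_left hk hkj.le
      have hlim := ((ih k hik).const_mul 2).add
        ((tendsto_integral_sq_sub_of_edge hN hRA hirr hkj).const_mul 2)
      simp only [mul_zero, add_zero] at hlim
      refine squeeze_zero' (Eventually.of_forall fun t => integral_nonneg fun ω => sq_nonneg _)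
        ?_ hlim
      filter_upwards [eventually_ge_atTop 1] with t ht
      have h1 := (integrable_sq_sub hRA ht i k).const_mul 2
      have h2 := (integrable_sq_sub hRA ht k j).const_mul 2
      rw [← integral_const_mul, ← integral_const_mul, ← integral_add h1 h2]
      refine integral_mono (integrable_sq_sub hRA ht i j) (h1.add h2) fun ω => ?_
      dsimp only
      nlinarith [sq_nonneg ((x t ω i - x t ω k) - (x t ω k - x t ω j))]
  obtain ⟨n, hn⟩ := hirr i j
  exact hpow n j hn

theorem energy_ge_of_not_corner {y : Fin N → ℝ} (hy : ∀ j, y j ∈ Set.Icc (0 : ℝ) 1) {δ : ℝ}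
    (hδ : δ ∈ Set.Ioo (0 : ℝ) (1 / 2)) (h0 : ¬ ∀ i, y i < δ) (h1 : ¬ ∀ i, 1 - δ < y i) :
    min (δ * (1 - δ)) ((1 - 2 * δ) ^ 2) ≤
      ∑ i, y i * (1 - y i) + ∑ i, ∑ j, (y i - y j) ^ 2 := by
  obtain ⟨hδ0, hδ1⟩ := hδ
  push Not at h0 h1
  obtain ⟨i, hi⟩ := h0
  obtain ⟨j, hj⟩ := h1
  have hnn : ∀ k, 0 ≤ y k * (1 - y k) := fun k =>
    mul_nonneg (hy k).1 (sub_nonneg.2 (hy k).2)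
  have hA : ∀ k, y k * (1 - y k) ≤ ∑ i, y i * (1 - y i) := fun k =>
    Finset.single_le_sum (f := fun i => y i * (1 - y i)) (fun i _ => hnn i) (Finset.mem_univ k)
  have hB : (y i - y j) ^ 2 ≤ ∑ i, ∑ j, (y i - y j) ^ 2 :=
    (Finset.single_le_sum (f := fun j => (y i - y j) ^ 2) (fun j _ => sq_nonneg _)
      (Finset.mem_univ j)).trans
      (Finset.single_le_sum (f := fun i => ∑ j, (y i - y j) ^ 2)
        (fun i _ => Finset.sum_nonneg fun j _ => sq_nonneg _) (Finset.mem_univ i))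
  have hA0 := (hnn i).trans (hA i)
  have hB0 := (sq_nonneg (y i - y j)).trans hB
  by_cases hi' : y i ≤ 1 - δ
  · refine (min_le_left _ _).trans ?_
    nlinarith [hA i]
  by_cases hj' : δ ≤ y j
  · refine (min_le_left _ _).trans ?_
    nlinarith [hA j]
  · refine (min_le_right _ _).trans ?_
    push Not at hi' hj'
    nlinarith

theorem tendsto_integral_energy (hN : 1 ≤ N) (hRA : IsRAModel μ α W x a)
    (hirr : Irreducible W) :
    Tendsto (fun t => ∫ ω, (∑ i, x t ω i * (1 - x t ω i) +
      ∑ i, ∑ j, (x t ω i - x t ω j) ^ 2) ∂μ) atTop (nhds 0) := by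
  have := hRA.isProb
  have hlim := (tendsto_finsetSum Finset.univ fun i _ =>
      tendsto_integral_x_mul_one_sub hN hRA hirr i).add
    (tendsto_finsetSum Finset.univ fun i _ => tendsto_finsetSum Finset.univ fun j _ =>
      tendsto_integral_sq_sub hN hRA hirr i j)
  simp only [Finset.sum_const_zero, add_zero] at hlim
  refine hlim.congr' ?_
  filter_upwards [eventually_ge_atTop 1] with t ht
  have hf : ∀ i, Integrable (fun ω => x t ω i * (1 - x t ω i)) μ := fun i =>
    (memLp_top_mul (memLp_x hRA ht i) ((memLp_const 1).sub (memLp_x hRA ht i))).integrable le_top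
  have hd := integrable_sq_sub hRA ht
  have hd' : ∀ i, Integrable (fun ω => ∑ j, (x t ω i - x t ω j) ^ 2) μ := fun i =>
    integrable_finsetSum _ fun j _ => hd i j
  rw [integral_add (integrable_finsetSum _ fun i _ => hf i)
    (integrable_finsetSum _ fun i _ => hd' i), integral_finsetSum _ fun i _ => hf i,
    integral_finsetSum _ fun i _ => hd' i]
  simp_rw [integral_finsetSum Finset.univ fun j _ => hd _ j]

end Limits

theorem ra_converges_in_probability {Ω : Type*} [MeasurableSpace Ω] {N : ℕ} (hN : 1 ≤ N)
    (μ : Measure Ω) (α : ℝ) (W : Matrix (Fin N) (Fin N) ℝ)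
    (x a : ℕ → Ω → Fin N → ℝ) (hRA : IsRAModel μ α W x a)
    (hirr : Irreducible W) :
    ∀ ε > (0 : ℝ), ∀ δ ∈ Set.Ioo (0 : ℝ) (1/2), ∃ tstar : ℕ, ∀ t ≥ tstar,
      (μ (corner0 x δ t)).toReal + (μ (corner1 x δ t)).toReal > 1 - ε := by
  intro ε hε δ hδ
  have := hRA.isProb
  set c := min (δ * (1 - δ)) ((1 - 2 * δ) ^ 2) with hcdef
  have hc : 0 < c := lt_min (mul_pos hδ.1 (by linarith [hδ.2]))
    (pow_pos (by linarith [hδ.2]) 2)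
  have hev := (tendsto_integral_energy hN hRA hirr).eventually (gt_mem_nhds (mul_pos hc hε))
  obtain ⟨T, hT⟩ := eventually_atTop.1 (hev.and (eventually_ge_atTop 1))
  refine ⟨T, fun t htT => ?_⟩
  obtain ⟨hlt, ht⟩ := hT t htT
  set E : Ω → ℝ := fun ω => ∑ i, x t ω i * (1 - x t ω i) +
    ∑ i, ∑ j, (x t ω i - x t ω j) ^ 2 with hE
  have hEnn : ∀ ω, 0 ≤ E ω := fun ω => add_nonneg
    (Finset.sum_nonneg fun i _ => x_mul_one_sub_nonneg hRA ht i ω)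
    (Finset.sum_nonneg fun i _ => Finset.sum_nonneg fun j _ => sq_nonneg _)
  have hEint : Integrable E μ :=
    (integrable_finsetSum _ fun i _ => (memLp_top_mul (memLp_x hRA ht i)
      ((memLp_const 1).sub (memLp_x hRA ht i))).integrable le_top).add
    (integrable_finsetSum _ fun i _ => integrable_finsetSum _ fun j _ =>
      integrable_sq_sub hRA ht i j)
  have hmarkov : c * μ.real {ω | c ≤ E ω} ≤ ∫ ω, E ω ∂μ :=
    mul_meas_ge_le_integral_of_nonneg (Eventually.of_forall hEnn) hEint c
  have hsmall : μ.real {ω | c ≤ E ω} < ε :=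
    lt_of_mul_lt_mul_left (hmarkov.trans_lt hlt) hc.le
  have hcover : (Set.univ : Set Ω) ⊆
      (corner0 x δ t ∪ corner1 x δ t) ∪ {ω | c ≤ E ω} := fun ω _ => by
    by_contra h
    simp only [Set.mem_union, not_or] at h
    exact h.2 (energy_ge_of_not_corner (hRA.x_mem t ht ω) hδ h.1.1 h.1.2)
  have h1 : (1 : ℝ) ≤ μ.real (corner0 x δ t) + μ.real (corner1 x δ t) +
      μ.real {ω | c ≤ E ω} := by
    calc (1 : ℝ) = μ.real Set.univ := by simp
      _ ≤ μ.real ((corner0 x δ t ∪ corner1 x δ t) ∪ {ω | c ≤ E ω}) := measureReal_mono hcover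
      _ ≤ _ := (measureReal_union_le _ _).trans
        (add_le_add_left (measureReal_union_le _ _) _)
  change μ.real (corner0 x δ t) + μ.real (corner1 x δ t) > 1 - ε
  linarith

end RA
end
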